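/- arXiv:1102.4394 — 5 statements merged into one kernel-verified Lean document; each statement's English description precedes it below -/
import Mathlib

section
/- Let p > 1. If Ω ⊊ ℝ^N is an open convex set and x ∈ Ω, then D_{Ω,p}(x) ≤ dist(x, Ω^c). -/
open MeasureTheory Metric Set

noncomputable def dirDist {N : ℕ} (Ω : Set (EuclideanSpace ℝ (Fin N)))
    (x e : EuclideanSpace ℝ (Fin N)) : ℝ :=
  sInf {r : ℝ | ∃ t : ℝ, r = |t| ∧ x + t • e ∈ Ωᶜ}

noncomputable def daviesWeight {N : ℕ} (Ω : Set (EuclideanSpace ℝ (Fin N)))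
    (x : EuclideanSpace ℝ (Fin N)) : ℝ :=
  ((N : ℝ) * ⨍ e : sphere (0 : EuclideanSpace ℝ (Fin N)) 1,
      (dirDist Ω x (e : EuclideanSpace ℝ (Fin N)) ^ 2)⁻¹ ∂volume.toSphere) ^ (-(1:ℝ)/2)

noncomputable def daviesWeightP {N : ℕ} (p : ℝ) (Ω : Set (EuclideanSpace ℝ (Fin N)))
    (x : EuclideanSpace ℝ (Fin N)) : ℝ :=
  (Real.sqrt Real.pi * Real.Gamma ((N + p)/2) / (Real.Gamma ((p+1)/2) * Real.Gamma (N/2)) *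
    ⨍ e : sphere (0 : EuclideanSpace ℝ (Fin N)) 1,
      dirDist Ω x (e : EuclideanSpace ℝ (Fin N)) ^ (-p) ∂volume.toSphere) ^ (-1/p)

theorem integral_Ioi_rpow_mul_exp_neg_sq {q : ℝ} (hq : -1 < q) :
    ∫ r in Ioi (0 : ℝ), r ^ q * Real.exp (-r ^ 2) = Real.Gamma ((q + 1) / 2) / 2 := by
  have h := integral_rpow_mul_exp_neg_rpow (p := 2) two_pos hq
  simp only [Real.rpow_two] at h
  rw [h]
  ring

theorem integral_abs_rpow_mul_exp_neg_sq {q : ℝ} (hq : -1 < q) :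
    ∫ t : ℝ, |t| ^ q * Real.exp (-t ^ 2) = Real.Gamma ((q + 1) / 2) := by
  have h := integral_comp_abs (f := fun r : ℝ => r ^ q * Real.exp (-r ^ 2))
  simp only [sq_abs] at h
  rw [h, integral_Ioi_rpow_mul_exp_neg_sq hq]
  ring

section

variable {E : Type*} [NormedAddCommGroup E] [InnerProductSpace ℝ E] [FiniteDimensional ℝ E]
  [MeasurableSpace E] [BorelSpace E]

theorem OrthonormalBasis.integral_abs_inner_rpow_mul_exp_neg_norm_sq {ι : Type*} [Fintype ι]
    (b : OrthonormalBasis ι ℝ E) (i₀ : ι) {q : ℝ} (hq : -1 < q) :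
    ∫ x : E, |inner ℝ (b i₀) x| ^ q * Real.exp (-‖x‖ ^ 2) =
      Real.Gamma ((q + 1) / 2) * Real.Gamma (1 / 2) ^ (Fintype.card ι - 1) := by
  classical
  let e : ι → ℝ := fun i => if i = i₀ then q else 0
  have hmp := b.measurePreserving_repr_symm.comp (PiLp.volume_preserving_toLp ι)
  have hme : MeasurableEmbedding (b.repr.symm ∘ (WithLp.toLp 2 : (ι → ℝ) → _)) :=
    b.repr.symm.toHomeomorph.measurableEmbedding.comp
      (MeasurableEquiv.toLp 2 (ι → ℝ)).measurableEmbedding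
  rw [← hmp.integral_comp hme]
  have key (v : ι → ℝ) :
      |inner ℝ (b i₀) ((b.repr.symm ∘ WithLp.toLp 2) v)| ^ q *
        Real.exp (-‖(b.repr.symm ∘ WithLp.toLp 2) v‖ ^ 2) =
      ∏ i, |v i| ^ e i * Real.exp (-v i ^ 2) := by
    rw [Finset.prod_mul_distrib, ← Real.exp_sum, Finset.prod_eq_single i₀]
    · rw [← b.repr_apply_apply]
      simp [e, EuclideanSpace.norm_sq_eq]
    · intro i _ hi
      simp [e, hi]
    · simp
  simp_rw [key]
  rw [volume_pi, integral_fintype_prod_eq_prod (f := fun i t => |t| ^ e i * Real.exp (-t ^ 2)),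
    ← Finset.mul_prod_erase _ _ (Finset.mem_univ i₀)]
  congr 1
  · simpa [e] using integral_abs_rpow_mul_exp_neg_sq hq
  · rw [Finset.prod_eq_pow_card (b := Real.Gamma (1 / 2)),
      Finset.card_erase_of_mem (Finset.mem_univ _), Finset.card_univ]
    intro i hi
    have := integral_abs_rpow_mul_exp_neg_sq (q := 0) (by norm_num)
    simpa [e, Finset.ne_of_mem_erase hi] using this

theorem integral_abs_inner_rpow_mul_exp_neg_norm_sq_eq_toSphere [Nontrivial E] (u : E) {q : ℝ}
    (hq : 0 ≤ q) :
    ∫ x : E, |inner ℝ u x| ^ q * Real.exp (-‖x‖ ^ 2) =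
      (∫ e : sphere (0 : E) 1, |inner ℝ u (e : E)| ^ q ∂volume.toSphere) *
        (Real.Gamma ((Module.finrank ℝ E + q) / 2) / 2) := by
  have hd : 0 < Module.finrank ℝ E := Module.finrank_pos
  calc
    _ = ∫ x : ({0}ᶜ : Set E), |inner ℝ u (x : E)| ^ q * Real.exp (-‖(x : E)‖ ^ 2)
          ∂((volume : Measure E).comap (↑)) := by
      rw [integral_subtype_comap (measurableSet_singleton _).compl
        fun x : E => |inner ℝ u x| ^ q * Real.exp (-‖x‖ ^ 2), restrict_compl_singleton]
    _ = ∫ z : sphere (0 : E) 1 × Ioi (0 : ℝ), |inner ℝ u (z.1 : E)| ^ q *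
          ((z.2 : ℝ) ^ q * Real.exp (-(z.2 : ℝ) ^ 2))
          ∂(volume.toSphere.prod (.volumeIoiPow (Module.finrank ℝ E - 1))) := by
      rw [← (volume : Measure E).measurePreserving_homeomorphUnitSphereProd.integral_comp
        (Homeomorph.measurableEmbedding _)]
      refine integral_congr_ae (.of_forall fun x => ?_)
      have hx : 0 < ‖(x : E)‖ := norm_pos_iff.2 x.2
      simp only [homeomorphUnitSphereProd_apply_fst_coe, homeomorphUnitSphereProd_apply_snd_coe,
        inner_smul_right, abs_mul, abs_inv, abs_norm]
      rw [← mul_assoc, ← Real.mul_rpow (by positivity) (by positivity)]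
      congr 2
      field_simp
    _ = _ := by
      rw [integral_prod_mul (f := fun e : sphere (0 : E) 1 => |inner ℝ u (e : E)| ^ q)
        (g := fun r : Ioi (0 : ℝ) => (r : ℝ) ^ q * Real.exp (-(r : ℝ) ^ 2))]
      congr 1
      simp only [Measure.volumeIoiPow, ENNReal.ofReal]
      rw [integral_withDensity_eq_integral_smul
          (measurable_subtype_coe.pow_const _).real_toNNReal,
        integral_subtype_comap measurableSet_Ioi fun r : ℝ =>
          Real.toNNReal (r ^ (Module.finrank ℝ E - 1)) • (r ^ q * Real.exp (-r ^ 2))]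
      have h := integral_Ioi_rpow_mul_exp_neg_sq (q := (Module.finrank ℝ E - 1 : ℕ) + q)
        (by have := (Module.finrank ℝ E - 1).cast_nonneg (α := ℝ); linarith)
      rw [Nat.cast_pred hd, show (Module.finrank ℝ E : ℝ) - 1 + q + 1 = Module.finrank ℝ E + q by
        ring] at h
      rw [← h]
      refine setIntegral_congr_fun measurableSet_Ioi fun r hr => ?_
      rw [mem_Ioi] at hr
      simp only [NNReal.smul_def, Real.coe_toNNReal _ (pow_nonneg hr.le _), smul_eq_mul]
      rw [← mul_assoc, ← Real.rpow_natCast, ← Real.rpow_add hr, Nat.cast_pred hd]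

theorem average_toSphere_abs_inner_rpow {u : E} (hu : ‖u‖ = 1) {q : ℝ} (hq : 0 ≤ q) :
    ⨍ e : sphere (0 : E) 1, |inner ℝ u (e : E)| ^ q ∂volume.toSphere =
      Real.Gamma ((q + 1) / 2) * Real.Gamma (Module.finrank ℝ E / 2) /
        (√Real.pi * Real.Gamma ((Module.finrank ℝ E + q) / 2)) := by
  have : Nontrivial E := ⟨u, 0, by rintro rfl; simp at hu⟩
  have hd : 0 < Module.finrank ℝ E := Module.finrank_pos
  let i₀ : Fin (Module.finrank ℝ E) := ⟨0, hd⟩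
  obtain ⟨b, hb⟩ := Orthonormal.exists_orthonormalBasis_extension_of_card_eq (𝕜 := ℝ) (E := E)
    (ι := Fin (Module.finrank ℝ E)) (by simp) (v := fun _ => u) (s := {i₀})
    ⟨fun _ => by simpa using hu, fun i j hij => absurd (Subsingleton.elim i j) hij⟩
  have hb0 : b i₀ = u := hb i₀ rfl
  have h (s : ℝ) (hs : 0 ≤ s) :=
    (integral_abs_inner_rpow_mul_exp_neg_norm_sq_eq_toSphere u hs).symm.trans
    (hb0 ▸ b.integral_abs_inner_rpow_mul_exp_neg_norm_sq i₀ (show -1 < s by linarith))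
  have h0 := h 0 le_rfl
  have hq' := h q hq
  have hG1 : 0 < Real.Gamma (Module.finrank ℝ E / 2) := Real.Gamma_pos_of_pos (by positivity)
  have hG2 : 0 < Real.Gamma ((Module.finrank ℝ E + q) / 2) := Real.Gamma_pos_of_pos (by positivity)
  have hpi : 0 < √Real.pi := by positivity
  simp only [Real.rpow_zero, integral_const, smul_eq_mul, mul_one, add_zero, zero_add,
    Real.Gamma_one_half_eq] at h0 hq'
  rw [average_eq, smul_eq_mul]
  set S := (volume : Measure E).toSphere.real univ
  set I := ∫ e : sphere (0 : E) 1, |inner ℝ u (e : E)| ^ q ∂volume.toSphere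
  have hS : S ≠ 0 := by
    rintro hS
    rw [hS, zero_mul] at h0
    exact absurd h0 (by positivity)
  set P := √Real.pi ^ (Fintype.card (Fin (Module.finrank ℝ E)) - 1)
  have hP : 0 < P := by positivity
  field_simp
  have : P * (I * √Real.pi * Real.Gamma ((Module.finrank ℝ E + q) / 2)) =
      P * (S * Real.Gamma ((q + 1) / 2) * Real.Gamma (Module.finrank ℝ E / 2)) := by
    linear_combination 2 * √Real.pi * P * hq' - 2 * Real.Gamma ((q + 1) / 2) * P * h0
  have := mul_left_cancel₀ hP.ne' this
  linarith

end

section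

variable {N : ℕ} {Ω : Set (EuclideanSpace ℝ (Fin N))} {x : EuclideanSpace ℝ (Fin N)}

theorem exists_continuous_dirDist_eq_inv (hΩ : IsOpen Ω) (hconv : Convex ℝ Ω) (hx : x ∈ Ω) :
    ∃ g : EuclideanSpace ℝ (Fin N) → ℝ, Continuous g ∧ (∀ e, 0 ≤ g e) ∧
      (∀ e, dirDist Ω x e = (g e)⁻¹) ∧
      ∀ e (t : ℝ), x + t • e ∉ Ω → 1 ≤ |t| * g e := by
  let K : Set (EuclideanSpace ℝ (Fin N)) := {v | x + v ∈ Ω ∧ x - v ∈ Ω}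
  have hKsymm : ∀ v ∈ K, -v ∈ K := fun v hv => by
    simpa [K, sub_eq_add_neg, and_comm] using hv
  have hKopen : IsOpen K := (hΩ.preimage (by fun_prop : Continuous (x + ·))).inter
    (hΩ.preimage (by fun_prop : Continuous (x - ·)))
  have hKconv : Convex ℝ K := by
    intro v hv w hw a b ha hb hab
    have h1 := hconv hv.1 hw.1 ha hb hab
    have h2 := hconv hv.2 hw.2 ha hb hab
    have hxab : a • x + b • x = x := by rw [← add_smul, hab, one_smul]
    refine ⟨?_, ?_⟩
    · convert h1 using 1
      nth_rewrite 1 [← hxab]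
      module
    · convert h2 using 1
      nth_rewrite 1 [← hxab]
      module
  have hK0 : (0 : EuclideanSpace ℝ (Fin N)) ∈ K := by simpa [K] using hx
  have hKnhds := hKopen.mem_nhds hK0
  have hmem (v : EuclideanSpace ℝ (Fin N)) : gauge K v < 1 ↔ v ∈ K := by
    rw [gauge_lt_one_iff_mem_interior hKconv hKnhds, hKopen.interior_eq]
  have hsmul (e : EuclideanSpace ℝ (Fin N)) (t : ℝ) : gauge K (t • e) = |t| * gauge K e := by
    rcases le_total 0 t with ht | ht
    · rw [gauge_smul_of_nonneg ht, abs_of_nonneg ht, smul_eq_mul]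
    · rw [← gauge_neg hKsymm, ← neg_smul, gauge_smul_of_nonneg (neg_nonneg.2 ht),
        abs_of_nonpos ht, smul_eq_mul]
  have hexit (e : EuclideanSpace ℝ (Fin N)) (t : ℝ) (ht : x + t • e ∉ Ω) :
      1 ≤ |t| * gauge K e := by
    rw [← hsmul, ← not_lt, hmem]
    exact fun h => ht h.1
  refine ⟨gauge K, continuous_gauge hKconv hKnhds, gauge_nonneg, fun e => ?_, hexit⟩
  have hset : {r : ℝ | ∃ t : ℝ, r = |t| ∧ x + t • e ∈ Ωᶜ} = {r | 0 ≤ r ∧ 1 ≤ r * gauge K e} := by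
    ext r
    constructor
    · rintro ⟨t, rfl, ht⟩
      exact ⟨abs_nonneg t, hexit e t ht⟩
    · rintro ⟨hr, h⟩
      have hrK : r • e ∉ K := by
        rw [← hmem, hsmul, abs_of_nonneg hr]
        exact h.not_gt
      by_cases hr1 : x + r • e ∈ Ω
      · refine ⟨-r, by rw [abs_neg, abs_of_nonneg hr], fun h' => hrK ⟨hr1, ?_⟩⟩
        rwa [sub_eq_add_neg, ← neg_smul]
      · exact ⟨r, (abs_of_nonneg hr).symm, hr1⟩
  rw [dirDist, hset]
  rcases (gauge_nonneg (s := K) e).eq_or_lt with h0 | hpos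
  · simp [← h0, not_le.2 (zero_lt_one' ℝ)]
  · have hIci : {r | 0 ≤ r ∧ 1 ≤ r * gauge K e} = Ici (gauge K e)⁻¹ := by
      ext r
      rw [mem_ofPred_eq, mem_Ici, inv_le_iff_one_le_mul₀ hpos]
      refine ⟨And.right, fun h => ⟨?_, h⟩⟩
      by_contra! hr
      nlinarith
    rw [hIci, csInf_Ici]

theorem exists_unit_forall_inner_le_infDist (hΩ : IsOpen Ω) (hconv : Convex ℝ Ω)
    (hne : Ω ≠ univ) (hx : x ∈ Ω) :
    ∃ u : EuclideanSpace ℝ (Fin N), ‖u‖ = 1 ∧ ∃ s : ℝ, 0 < s ∧ s ≤ infDist x Ωᶜ ∧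
      ∀ v, s ≤ inner ℝ u v → x + v ∉ Ω := by
  obtain ⟨y, hy, hxy⟩ := hΩ.isClosed_compl.exists_infDist_eq_dist (nonempty_compl.2 hne) x
  obtain ⟨f, hf⟩ := geometric_hahn_banach_open_point hconv hΩ hy
  obtain ⟨w, rfl⟩ := (InnerProductSpace.toDual ℝ (EuclideanSpace ℝ (Fin N))).surjective f
  simp only [InnerProductSpace.toDual_apply_apply] at hf
  have hw : w ≠ 0 := by
    rintro rfl
    simpa using hf x hx
  have hw' : 0 < ‖w‖ := norm_pos_iff.2 hw
  have hu : ‖(‖w‖⁻¹ • w)‖ = 1 := by rw [norm_smul, norm_inv, norm_norm, inv_mul_cancel₀ hw'.ne']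
  refine ⟨‖w‖⁻¹ • w, hu, inner ℝ (‖w‖⁻¹ • w) (y - x), ?_, ?_, fun v hv hvΩ => ?_⟩
  · rw [real_inner_smul_left, inner_sub_right]
    have := hf x hx
    exact mul_pos (inv_pos.2 hw') (by linarith)
  · rw [hxy, dist_comm, dist_eq_norm]
    simpa [hu] using real_inner_le_norm (‖w‖⁻¹ • w) (y - x)
  · rw [real_inner_smul_left, real_inner_smul_left] at hv
    have h1 := le_of_mul_le_mul_left hv (inv_pos.2 hw')
    have h2 := hf _ hvΩ
    rw [inner_sub_right] at h1
    rw [inner_add_right] at h2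
    linarith

theorem infDist_rpow_neg_mul_average_le (hΩ : IsOpen Ω) (hconv : Convex ℝ Ω)
    (hne : Ω ≠ univ) (hx : x ∈ Ω) {p : ℝ} (hp : 0 < p) :
    ∃ u : EuclideanSpace ℝ (Fin N), ‖u‖ = 1 ∧
      infDist x Ωᶜ ^ (-p) *
        ⨍ e : sphere (0 : EuclideanSpace ℝ (Fin N)) 1,
          |inner ℝ u (e : EuclideanSpace ℝ (Fin N))| ^ p ∂volume.toSphere ≤
      ⨍ e : sphere (0 : EuclideanSpace ℝ (Fin N)) 1,
        dirDist Ω x (e : EuclideanSpace ℝ (Fin N)) ^ (-p) ∂volume.toSphere := by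
  obtain ⟨u, hu, s, hs, hsδ, hout⟩ := exists_unit_forall_inner_le_infDist hΩ hconv hne hx
  obtain ⟨g, hgc, hg0, hgd, hg⟩ := exists_continuous_dirDist_eq_inv hΩ hconv hx
  refine ⟨u, hu, ?_⟩
  have hδ : 0 < infDist x Ωᶜ := hs.trans_le hsδ
  have hdg (e : EuclideanSpace ℝ (Fin N)) : dirDist Ω x e ^ (-p) = g e ^ p := by
    rw [hgd, Real.rpow_neg (inv_nonneg.2 (hg0 e)), Real.inv_rpow (hg0 e), inv_inv]
  have hle (e : EuclideanSpace ℝ (Fin N)) : |inner ℝ u e| ≤ infDist x Ωᶜ * g e := by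
    by_cases h : inner ℝ u e = (0 : ℝ)
    · rw [h, abs_zero]
      exact mul_nonneg hδ.le (hg0 e)
    · have h1 := hg e (s / inner ℝ u e) (hout _ (by
        rw [real_inner_smul_right, div_mul_cancel₀ _ h]))
      rw [abs_div, abs_of_pos hs, div_mul_eq_mul_div, one_le_div (abs_pos.2 h)] at h1
      exact h1.trans (mul_le_mul_of_nonneg_right hsδ (hg0 e))
  simp only [hdg, average_eq, smul_eq_mul]
  rw [mul_left_comm, ← integral_const_mul]
  refine mul_le_mul_of_nonneg_left (integral_mono ?_ ?_ fun e => ?_) (by positivity)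
  · refine Continuous.integrable_of_hasCompactSupport ?_ (.of_compactSpace _)
    exact continuous_const.mul (Continuous.rpow_const (by fun_prop) fun _ => .inr hp.le)
  · refine Continuous.integrable_of_hasCompactSupport ?_ (.of_compactSpace _)
    exact Continuous.rpow_const (by fun_prop) fun _ => .inr hp.le
  · have h := Real.rpow_le_rpow (abs_nonneg _) (hle e) hp.le
    rw [Real.mul_rpow hδ.le (hg0 _)] at h
    dsimp only
    rwa [Real.rpow_neg hδ.le, inv_mul_le_iff₀ (by positivity)]

end

/-- For `p > 1`, an open convex proper subset `Ω ⊊ ℝ^N` and `x ∈ Ω`, the weight `D_{Ω,p}`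
satisfies `D_{Ω,p}(x) ≤ dist(x, Ωᶜ)`. -/
theorem daviesWeightP_le_infDist_of_convex (N : ℕ) (p : ℝ) (hp : 1 < p)
    (Ω : Set (EuclideanSpace ℝ (Fin N))) (hΩ : IsOpen Ω) (hconv : Convex ℝ Ω)
    (hne : Ω ≠ Set.univ) (x : EuclideanSpace ℝ (Fin N)) (hx : x ∈ Ω) :
    daviesWeightP p Ω x ≤ Metric.infDist x Ωᶜ := by
  have hp0 : 0 < p := one_pos.trans hp
  have hδ : 0 < infDist x Ωᶜ :=
    (hΩ.isClosed_compl.notMem_iff_infDist_pos (nonempty_compl.2 hne)).1 (not_not.2 hx)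
  obtain ⟨u, hu, h⟩ := infDist_rpow_neg_mul_average_le hΩ hconv hne hx hp0
  have hN : 0 < N := by
    rcases N.eq_zero_or_pos with rfl | hN
    · simp [Subsingleton.elim u 0] at hu
    · exact hN
  rw [average_toSphere_abs_inner_rpow hu hp0.le, finrank_euclideanSpace_fin] at h
  have hG1 : 0 < Real.Gamma ((N : ℝ) / 2) := Real.Gamma_pos_of_pos (by positivity)
  have hG2 : 0 < Real.Gamma ((N + p) / 2) := Real.Gamma_pos_of_pos (by positivity)
  have hG3 : 0 < Real.Gamma ((p + 1) / 2) := Real.Gamma_pos_of_pos (by positivity)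
  have hpi : 0 < √Real.pi := by positivity
  have key : infDist x Ωᶜ ^ (-p) ≤
      √Real.pi * Real.Gamma ((N + p) / 2) / (Real.Gamma ((p + 1) / 2) * Real.Gamma (N / 2)) *
        ⨍ e : sphere (0 : EuclideanSpace ℝ (Fin N)) 1,
          dirDist Ω x (e : EuclideanSpace ℝ (Fin N)) ^ (-p) ∂volume.toSphere := by
    refine le_trans (le_of_eq ?_) (mul_le_mul_of_nonneg_left h (by positivity))
    field_simp
  calc
    daviesWeightP p Ω x ≤ (infDist x Ωᶜ ^ (-p)) ^ (-1 / p) :=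
      Real.rpow_le_rpow_of_nonpos (by positivity) key
        (div_nonpos_of_nonpos_of_nonneg (by norm_num) hp0.le)
    _ = infDist x Ωᶜ := by
      rw [← Real.rpow_mul hδ.le, show -p * (-1 / p) = 1 by field_simp, Real.rpow_one]
end

section
/- Let q ≥ 2. For every f ∈ C_0^∞(−1, 1) and every t ∈ [−1, 1] one has |f(t)|^{q+2} ≤ (q+2)² · ( ∫_{−1}^{1} ( |f′(s)|² − |f(s)|²/(4(1−|s|)²) ) ds ) · ( ∫_{−1}^{1} |f(s)|^q ds ). -/
open MeasureTheory Set

section HalfInterval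

variable {E : Type*} [NormedAddCommGroup E] [InnerProductSpace ℝ E]

theorem hasDerivAt_norm_rpow_add_one {φ : ℝ → E} {φ' : E} {x m : ℝ} (hm : 0 < m)
    (h : HasDerivAt φ φ' x) :
    HasDerivAt (fun y => ‖φ y‖ ^ (m + 1)) ((m + 1) * ‖φ x‖ ^ (m - 1) * inner ℝ (φ x) φ') x := by
  have h1 := (hasFDerivAt_norm_rpow (φ x) (p := m + 1) (by linarith)).comp_hasDerivAt x h
  refine h1.congr_deriv ?_
  simp [show m + 1 - 2 = m - 1 by ring]

/-- The pointwise inequality behind the bound at the centre of the interval. -/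
theorem centre_integrand_le {m l x N F P v u s k : ℝ} (hm : 1 ≤ m) (hl : 0 ≤ l) (hx0 : 0 ≤ x)
    (hx1 : x ≤ 1) (hv : 0 ≤ v) (hk : 0 ≤ k) (hF : 0 ≤ F) (hP : 0 ≤ P)
    (hFv : P * F = v) (hF2 : F ^ 2 = x ^ 2 * N ^ 2) (hu : u = s + x * N ^ 2 / 2)
    (hs : |s| ≤ F * k) :
    l * (v * F + x * ((m + 1) * P * u)) - (m + 1) / 2 * (F ^ 2 + x * (2 * u))
      ≤ (m + 1) * (l ^ 2 * v ^ 2 + k ^ 2) := by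
  subst hu
  obtain ⟨hs1, hs2⟩ := abs_le.mp hs
  have e1 : x * (P * s) ≤ v * k := by
    calc x * (P * s) ≤ x * (P * (F * k)) := by gcongr
      _ = x * (v * k) := by rw [← hFv]; ring
      _ ≤ v * k := mul_le_of_le_one_left (by positivity) hx1
  have e2 : P * (x ^ 2 * N ^ 2) = v * F := by rw [← hF2, ← hFv]; ring
  have e3 : -(x * s) ≤ F * k := by
    calc -(x * s) = x * (-s) := by ring
      _ ≤ x * (F * k) := by gcongr; linarith
      _ ≤ F * k := mul_le_of_le_one_left (by positivity) hx1
  have e4 : l * (v * F + x * ((m + 1) * P * (s + x * N ^ 2 / 2)))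
      ≤ (m + 1) * (l * (v * F) + l * (v * k)) := by
    have h1 : l * (v * F + x * ((m + 1) * P * (s + x * N ^ 2 / 2)))
        = l * (v * F) * (1 + (m + 1) / 2) + (m + 1) * (l * (x * (P * s))) := by
      linear_combination l * (m + 1) / 2 * e2
    have h2 : l * (v * F) * (1 + (m + 1) / 2) ≤ l * (v * F) * (m + 1) :=
      mul_le_mul_of_nonneg_left (by linarith) (by positivity)
    have h3 : (m + 1) * (l * (x * (P * s))) ≤ (m + 1) * (l * (v * k)) := by gcongr
    linarith
  have e5 : l * (v * F) + l * (v * k) - (F ^ 2 + x * s) ≤ l ^ 2 * v ^ 2 + k ^ 2 := by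
    nlinarith [sq_nonneg (l * v - F), sq_nonneg (l * v - k), sq_nonneg (F - k)]
  have e6 : F ^ 2 + x * (2 * (s + x * N ^ 2 / 2)) = 2 * (F ^ 2 + x * s) := by rw [hF2]; ring
  rw [e6]
  nlinarith

/-- A Hardy-type estimate on `(0,1)` for the function `x • ω x`, in Young form. -/
theorem hardy_young_of_smul {ω ω' : ℝ → E} (hω : ∀ x, HasDerivAt ω (ω' x) x)
    (hω' : Continuous ω') {m l r : ℝ} (hm : 1 ≤ m) (hl : 0 ≤ l) (hr : r ∈ Icc (0 : ℝ) 1) :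
    0 ≤ (∫ x in (0 : ℝ)..1, (‖ω x + x • ω' x‖ ^ 2 - ‖ω x‖ ^ 2 / 4)) ∧
    l * ‖ω 1‖ ^ (m + 1) ≤ (m + 1) * (l ^ 2 * (∫ x in (0 : ℝ)..1, (‖x • ω x‖ ^ m) ^ 2) +
      ∫ x in (0 : ℝ)..1, (‖ω x + x • ω' x‖ ^ 2 - ‖ω x‖ ^ 2 / 4)) ∧
    l * ‖r • ω r‖ ^ (m + 1) ≤ l * ‖ω 1‖ ^ (m + 1) +
      (m + 1) / 2 * (l ^ 2 * (∫ x in (0 : ℝ)..1, (‖x • ω x‖ ^ m) ^ 2) +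
      ∫ x in (0 : ℝ)..1, (‖ω x + x • ω' x‖ ^ 2 - ‖ω x‖ ^ 2 / 4)) := by
  have hωc : Continuous ω := continuous_iff_continuousAt.2 fun x => (hω x).continuousAt
  have hm0 : 0 < m := by linarith
  have hφ : ∀ x, HasDerivAt (fun y => y • ω y) (ω x + x • ω' x) x := fun x =>
    ((hasDerivAt_id' x).smul (hω x)).congr_deriv (by simp [add_comm])
  have hF := fun x => hasDerivAt_norm_rpow_add_one hm0 (hφ x)
  have hv : Continuous fun x => ‖x • ω x‖ ^ m :=
    (continuous_id.smul hωc).norm.rpow_const fun _ => Or.inr hm0.le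
  have hN : ∀ x, HasDerivAt (fun y => y * ‖ω y‖ ^ 2)
      (‖ω x‖ ^ 2 + x * (2 * inner ℝ (ω x) (ω' x))) x := fun x =>
    ((hasDerivAt_id' x).mul (hω x).norm_sq).congr_deriv (by simp)
  have hC : ∀ x, HasDerivAt (fun y => y * ‖y • ω y‖ ^ 2)
      (‖x • ω x‖ ^ 2 + x * (2 * inner ℝ (x • ω x) (ω x + x • ω' x))) x := fun x =>
    ((hasDerivAt_id' x).mul (hφ x).norm_sq).congr_deriv (by simp)
  have hA : ∀ x, HasDerivAt (fun y => y * ‖y • ω y‖ ^ (m + 1))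
      (‖x • ω x‖ ^ (m + 1) + x * ((m + 1) * ‖x • ω x‖ ^ (m - 1) *
        inner ℝ (x • ω x) (ω x + x • ω' x))) x := fun x =>
    ((hasDerivAt_id' x).mul (hF x)).congr_deriv (by simp)
  set D := ∫ x in (0 : ℝ)..1, (‖ω x + x • ω' x‖ ^ 2 - ‖ω x‖ ^ 2 / 4) with hD
  set I := ∫ x in (0 : ℝ)..1, (‖x • ω x‖ ^ m) ^ 2
  set K := ∫ x in (0 : ℝ)..1, ‖(2⁻¹ : ℝ) • ω x + x • ω' x‖ ^ 2 with hK
  have hK0 : 0 ≤ K := intervalIntegral.integral_nonneg zero_le_one fun x _ => by positivity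
  have hsplit : D = K + ‖ω 1‖ ^ 2 / 2 := by
    have h1 : ∫ x in (0 : ℝ)..1, (‖ω x‖ ^ 2 + x * (2 * inner ℝ (ω x) (ω' x))) = ‖ω 1‖ ^ 2 := by
      rw [intervalIntegral.integral_eq_sub_of_hasDerivAt (fun x _ => hN x)
        (Continuous.intervalIntegrable (by fun_prop) _ _)]
      simp
    rw [← h1, hK, ← intervalIntegral.integral_div, ← intervalIntegral.integral_add
      (Continuous.intervalIntegrable (by fun_prop) _ _)
      (Continuous.intervalIntegrable (by fun_prop) _ _), hD]
    congr 1 with x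
    simp only [norm_add_sq_real, norm_smul, inner_smul_left, inner_smul_right]
    norm_num
    ring
  have hIK : ∫ x in (0 : ℝ)..1, (l ^ 2 * (‖x • ω x‖ ^ m) ^ 2 +
      ‖(2⁻¹ : ℝ) • ω x + x • ω' x‖ ^ 2) = l ^ 2 * I + K := by
    rw [intervalIntegral.integral_add (Continuous.intervalIntegrable (by fun_prop) _ _)
      (Continuous.intervalIntegrable (by fun_prop) _ _), intervalIntegral.integral_const_mul]
  have hinner : ∀ x, inner ℝ (x • ω x) (ω x + x • ω' x) =
      inner ℝ (x • ω x) ((2⁻¹ : ℝ) • ω x + x • ω' x) + x * ‖ω x‖ ^ 2 / 2 := fun x => by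
    simp only [inner_add_right, inner_smul_left, inner_smul_right, real_inner_self_eq_norm_sq]
    simp
    ring
  have hpow1 : ∀ y : ℝ, 0 ≤ y → y ^ (m - 1) * y = y ^ m := fun y hy => by
    rw [← Real.rpow_add_one' hy (by simpa using hm0.ne')]; simp
  have hpow2 : ∀ y : ℝ, 0 ≤ y → y ^ (m + 1) = y ^ m * y := fun y hy =>
    Real.rpow_add_one' hy (by linarith)
  refine ⟨by rw [hsplit]; positivity, ?_, ?_⟩
  · have key := intervalIntegral.sub_le_integral_of_hasDeriv_right_of_le (a := (0 : ℝ)) (b := 1)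
      (g := fun y => l * (y * ‖y • ω y‖ ^ (m + 1)) - (m + 1) / 2 * (y * ‖y • ω y‖ ^ 2))
      (φ := fun x => (m + 1) * (l ^ 2 * (‖x • ω x‖ ^ m) ^ 2 +
        ‖(2⁻¹ : ℝ) • ω x + x • ω' x‖ ^ 2)) zero_le_one
      (fun x _ => (((hA x).const_mul l).sub
        ((hC x).const_mul ((m + 1) / 2))).continuousAt.continuousWithinAt)
      (fun x _ => (((hA x).const_mul l).sub ((hC x).const_mul ((m + 1) / 2))).hasDerivWithinAt)
      (Continuous.integrableOn_Icc (by fun_prop))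
      (fun x hx => by
        rw [hpow2 _ (norm_nonneg _)]
        refine centre_integrand_le hm hl hx.1.le hx.2.le (by positivity) (norm_nonneg _)
          (norm_nonneg _) (by positivity) (hpow1 _ (norm_nonneg _)) ?_ (hinner x)
          (abs_real_inner_le_norm _ _)
        rw [norm_smul, mul_pow, Real.norm_eq_abs, sq_abs])
    rw [intervalIntegral.integral_const_mul, hIK] at key
    simp only [one_smul, one_mul, zero_mul, mul_zero, sub_zero] at key
    rw [hsplit]
    linarith
  · have key := intervalIntegral.sub_le_integral_of_hasDeriv_right_of_le (a := r) (b := 1)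
      (g := fun y => -(l * ‖y • ω y‖ ^ (m + 1)))
      (φ := fun x => (m + 1) / 2 * (l ^ 2 * (‖x • ω x‖ ^ m) ^ 2 +
        ‖(2⁻¹ : ℝ) • ω x + x • ω' x‖ ^ 2)) hr.2
      (fun x _ => ((hF x).const_mul l).neg.continuousAt.continuousWithinAt)
      (fun x _ => ((hF x).const_mul l).neg.hasDerivWithinAt)
      (Continuous.integrableOn_Icc (by fun_prop))
      (fun x hx => by
        have hx0 : 0 ≤ x := hr.1.trans hx.1.le
        rw [hinner x]
        have hs := (abs_le.mp (abs_real_inner_le_norm (x • ω x)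
          ((2⁻¹ : ℝ) • ω x + x • ω' x))).1
        have hP : 0 ≤ ‖x • ω x‖ ^ (m - 1) := by positivity
        rw [← hpow1 _ (norm_nonneg (x • ω x))]
        set P := ‖x • ω x‖ ^ (m - 1)
        set F := ‖x • ω x‖
        set k := ‖(2⁻¹ : ℝ) • ω x + x • ω' x‖
        set s := (inner ℝ (x • ω x) ((2⁻¹ : ℝ) • ω x + x • ω' x) : ℝ)
        have h1 : l * P * -s ≤ l * P * (F * k) := by gcongr; linarith
        have h2 : 0 ≤ l * P * (x * ‖ω x‖ ^ 2 / 2) := by positivity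
        have h3 : l * P * -(s + x * ‖ω x‖ ^ 2 / 2) ≤
            1 / 2 * (l ^ 2 * (P * F) ^ 2 + k ^ 2) := by
          nlinarith [sq_nonneg (l * (P * F) - k)]
        nlinarith)
    have hmono : ∫ x in r..1, (m + 1) / 2 * (l ^ 2 * (‖x • ω x‖ ^ m) ^ 2 +
        ‖(2⁻¹ : ℝ) • ω x + x • ω' x‖ ^ 2) ≤ (m + 1) / 2 * (l ^ 2 * I + K) := by
      rw [← hIK, ← intervalIntegral.integral_const_mul]
      refine intervalIntegral.integral_mono_interval hr.1 hr.2 le_rfl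
        (.of_forall fun x => ?_) (Continuous.intervalIntegrable (by fun_prop) _ _)
      simp only [Pi.zero_apply]
      positivity
    have hle : (m + 1) / 2 * (l ^ 2 * I + K) ≤ (m + 1) / 2 * (l ^ 2 * I + D) := by
      gcongr
      rw [hsplit]
      linarith [sq_nonneg ‖ω 1‖]
    simp only [one_smul] at key
    linarith

/-- The estimate of `hardy_young_of_smul` for a function vanishing near the endpoint `0`. -/
theorem hardy_young_half_interval {φ : ℝ → E} (hφ : ContDiff ℝ 1 φ)
    (h0 : φ =ᶠ[nhds 0] 0) {m l r : ℝ} (hm : 1 ≤ m) (hl : 0 ≤ l) (hr : r ∈ Icc (0 : ℝ) 1) :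
    0 ≤ (∫ x in (0 : ℝ)..1, (‖deriv φ x‖ ^ 2 - ‖φ x‖ ^ 2 / (4 * x ^ 2))) ∧
    l * ‖φ 1‖ ^ (m + 1) ≤ (m + 1) * (l ^ 2 * (∫ x in (0 : ℝ)..1, (‖φ x‖ ^ m) ^ 2) +
      ∫ x in (0 : ℝ)..1, (‖deriv φ x‖ ^ 2 - ‖φ x‖ ^ 2 / (4 * x ^ 2))) ∧
    l * ‖φ r‖ ^ (m + 1) ≤ l * ‖φ 1‖ ^ (m + 1) +
      (m + 1) / 2 * (l ^ 2 * (∫ x in (0 : ℝ)..1, (‖φ x‖ ^ m) ^ 2) +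
      ∫ x in (0 : ℝ)..1, (‖deriv φ x‖ ^ 2 - ‖φ x‖ ^ 2 / (4 * x ^ 2))) := by
  have hω : ContDiff ℝ 1 fun x : ℝ => x⁻¹ • φ x := by
    refine contDiff_iff_contDiffAt.2 fun x => ?_
    by_cases hx : x = 0
    · subst hx
      refine (contDiffAt_const (c := (0 : E))).congr_of_eventuallyEq ?_
      filter_upwards [h0] with y hy
      simp [hy]
    · exact (contDiffAt_inv ℝ hx).smul hφ.contDiffAt
  have hφ0 : φ 0 = 0 := h0.eq_of_nhds
  have hsmul : ∀ x : ℝ, x • (x⁻¹ • φ x) = φ x := fun x => by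
    by_cases hx : x = 0
    · simp [hx, hφ0]
    · simp [smul_smul, hx]
  have hder := fun x => (hω.differentiable one_ne_zero x).hasDerivAt
  have hderiv : ∀ x : ℝ, x⁻¹ • φ x + x • deriv (fun x : ℝ => x⁻¹ • φ x) x = deriv φ x := fun x => by
    have h := (hasDerivAt_id x).smul (hder x)
    simp only [id, one_smul] at h
    rw [add_comm, ← h.deriv]
    exact congrArg (deriv · x) (funext hsmul)
  have hnorm : ∀ x : ℝ, ‖x⁻¹ • φ x‖ ^ 2 / 4 = ‖φ x‖ ^ 2 / (4 * x ^ 2) := fun x => by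
    rw [norm_smul, mul_pow, norm_inv, Real.norm_eq_abs, inv_pow, sq_abs, div_eq_mul_inv,
      div_eq_mul_inv, mul_inv]
    ring
  have := hardy_young_of_smul hder (hω.continuous_deriv le_rfl) hm hl hr
  simpa only [hsmul, hderiv, hnorm, inv_one, one_smul] using this

end HalfInterval

/-- A quotient is continuous if the numerator vanishes near the zeros of the denominator. -/
theorem Continuous.div_of_eventuallyEq_zero {f g : ℝ → ℝ} (hf : Continuous f) (hg : Continuous g)
    (h : ∀ x, g x = 0 → f =ᶠ[nhds x] 0) : Continuous fun x => f x / g x := by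
  refine continuous_iff_continuousAt.2 fun x => ?_
  by_cases hx : g x = 0
  · refine (continuousAt_const (y := (0 : ℝ))).congr ?_
    filter_upwards [h x hx] with y hy
    simp [hy]
  · exact hf.continuousAt.div hg.continuousAt hx

/-- **One-dimensional Hardy–Sobolev inequality** (Proposition 1 with the explicit constant
`C_q = (q+2)²`): for `q ≥ 2`, every `f ∈ C_0^∞(−1,1)` and every `t ∈ [−1,1]`,
`|f(t)|^{q+2} ≤ (q+2)² (∫_{−1}^1 (|f'|² − |f|²/(4(1−|s|)²)) ds) (∫_{−1}^1 |f|^q ds)`. -/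
theorem one_dim_hardy_sobolev (q : ℝ) (hq : 2 ≤ q) (f : ℝ → ℂ)
    (hf : ContDiff ℝ (⊤ : ℕ∞) f) (hsupp : HasCompactSupport f)
    (hsub : tsupport f ⊆ Set.Ioo (-1) 1) (t : ℝ) (ht : t ∈ Set.Icc (-1 : ℝ) 1) :
    ‖f t‖ ^ (q + 2) ≤ (q + 2) ^ 2 *
      (∫ s in Set.Ioo (-1 : ℝ) 1, (‖deriv f s‖ ^ 2 - ‖f s‖ ^ 2 / (4 * (1 - |s|) ^ 2))) *
      (∫ s in Set.Ioo (-1 : ℝ) 1, ‖f s‖ ^ q) := by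
  have hf1 : ContDiff ℝ 1 f := hf.of_le (by exact_mod_cast le_top)
  have hzero : ∀ x, |x| = 1 → f =ᶠ[nhds x] 0 := fun x hx =>
    notMem_tsupport_iff_eventuallyEq.1 fun h => (abs_lt.2 (hsub h)).ne hx
  have hdc : Continuous (deriv f) := hf1.continuous_deriv le_rfl
  have hfc := hf1.continuous
  have hDc : Continuous fun s => ‖deriv f s‖ ^ 2 - ‖f s‖ ^ 2 / (4 * (1 - |s|) ^ 2) := by
    refine (hdc.norm.pow 2).sub (Continuous.div_of_eventuallyEq_zero (by fun_prop)
      (by fun_prop) fun x hx => ?_)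
    have hx' : |x| = 1 := by
      have : 1 - |x| = 0 := by simpa using hx
      linarith
    filter_upwards [hzero x hx'] with y hy
    simp [hy]
  have hIc : Continuous fun s => (‖f s‖ ^ (q / 2)) ^ 2 :=
    (hfc.norm.rpow_const fun _ => Or.inr (by linarith)).pow 2
  have hpow : ∀ s, ‖f s‖ ^ q = (‖f s‖ ^ (q / 2)) ^ 2 := fun s => by
    rw [← Real.rpow_mul_natCast (norm_nonneg _)]; simp
  have split : ∀ {g : ℝ → ℝ}, Continuous g → ∫ s in Ioo (-1 : ℝ) 1, g s =
      (∫ r in (0 : ℝ)..1, g (1 - r)) + ∫ r in (0 : ℝ)..1, g (r - 1) := fun {g} hg => by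
    rw [← integral_Ioc_eq_integral_Ioo, ← intervalIntegral.integral_of_le (by norm_num),
      intervalIntegral.integral_comp_sub_left g, intervalIntegral.integral_comp_sub_right g,
      ← intervalIntegral.integral_add_adjacent_intervals (b := 0) (hg.intervalIntegrable _ _)
      (hg.intervalIntegrable _ _)]
    norm_num [add_comm]
  simp only [hpow]
  rw [split hDc, split hIc]
  have hright : ∀ {l r : ℝ}, 0 ≤ l → r ∈ Icc (0 : ℝ) 1 → _ := fun {l r} hl hr =>
    hardy_young_half_interval (φ := fun r => f (1 - r)) (m := q / 2) (l := l) (r := r)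
      (hf1.comp (contDiff_const.sub contDiff_id))
      ((Continuous.tendsto' (by fun_prop) 0 1 (by simp)).eventually (hzero 1 (by simp)))
      (by linarith) hl hr
  have hleft : ∀ {l r : ℝ}, 0 ≤ l → r ∈ Icc (0 : ℝ) 1 → _ := fun {l r} hl hr =>
    hardy_young_half_interval (φ := fun r => f (r - 1)) (m := q / 2) (l := l) (r := r)
      (hf1.comp (contDiff_id.sub contDiff_const))
      ((Continuous.tendsto' (by fun_prop) 0 (-1) (by simp)).eventually (hzero (-1) (by simp)))
      (by linarith) hl hr
  have hDr : ∫ r in (0 : ℝ)..1, (‖deriv (fun r => f (1 - r)) r‖ ^ 2 -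
      ‖f (1 - r)‖ ^ 2 / (4 * r ^ 2)) = ∫ r in (0 : ℝ)..1, (‖deriv f (1 - r)‖ ^ 2 -
      ‖f (1 - r)‖ ^ 2 / (4 * (1 - |1 - r|) ^ 2)) := by
    refine intervalIntegral.integral_congr fun r hr => ?_
    rw [uIcc_of_le zero_le_one] at hr
    simp only [deriv_comp_const_sub, norm_neg]
    rw [abs_of_nonneg (by linarith [hr.2]), sub_sub_cancel]
  have hDl : ∫ r in (0 : ℝ)..1, (‖deriv (fun r => f (r - 1)) r‖ ^ 2 -
      ‖f (r - 1)‖ ^ 2 / (4 * r ^ 2)) = ∫ r in (0 : ℝ)..1, (‖deriv f (r - 1)‖ ^ 2 -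
      ‖f (r - 1)‖ ^ 2 / (4 * (1 - |r - 1|) ^ 2)) := by
    refine intervalIntegral.integral_congr fun r hr => ?_
    rw [uIcc_of_le zero_le_one] at hr
    simp only [deriv_comp_sub_const]
    rw [abs_of_nonpos (by linarith [hr.2]), neg_sub, sub_sub_cancel]
  simp only [hDr, sub_self] at hright
  simp only [hDl, sub_self] at hleft
  set Dr := ∫ r in (0 : ℝ)..1, (‖deriv f (1 - r)‖ ^ 2 -
    ‖f (1 - r)‖ ^ 2 / (4 * (1 - |1 - r|) ^ 2))
  set Dl := ∫ r in (0 : ℝ)..1, (‖deriv f (r - 1)‖ ^ 2 -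
    ‖f (r - 1)‖ ^ 2 / (4 * (1 - |r - 1|) ^ 2))
  set Ir := ∫ r in (0 : ℝ)..1, (‖f (1 - r)‖ ^ (q / 2)) ^ 2
  set Il := ∫ r in (0 : ℝ)..1, (‖f (r - 1)‖ ^ (q / 2)) ^ 2
  have hIr : 0 ≤ Ir := intervalIntegral.integral_nonneg zero_le_one fun x _ => by positivity
  have hIl : 0 ≤ Il := intervalIntegral.integral_nonneg zero_le_one fun x _ => by positivity
  set W := ‖f t‖ ^ (q / 2 + 1) with hW
  have hW0 : 0 ≤ W := by positivity
  have hWsq : ‖f t‖ ^ (q + 2) = W ^ 2 := by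
    rw [hW, ← Real.rpow_mul_natCast (norm_nonneg _)]
    congr 1
    push_cast
    ring
  have h01 : (0 : ℝ) ∈ Icc (0 : ℝ) 1 := by simp
  have hDr0 := (hright le_rfl h01).1
  have hDl0 := (hleft le_rfl h01).1
  have young : ∀ l : ℝ, 0 ≤ l →
      2 * (l * W) ≤ (q + 2) * (l ^ 2 * (Ir + Il) + (Dr + Dl)) := fun l hl => by
    have c1 := (hright hl h01).2.1
    have c2 := (hleft hl h01).2.1
    have n1 : 0 ≤ (q / 2 + 1) / 2 * (l ^ 2 * Ir + Dr) := by
      have : 0 ≤ q := by linarith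
      positivity
    have n2 : 0 ≤ (q / 2 + 1) / 2 * (l ^ 2 * Il + Dl) := by
      have : 0 ≤ q := by linarith
      positivity
    rcases le_total 0 t with h | h
    · have c3 := (hright (r := 1 - t) hl ⟨by linarith [ht.2], by linarith⟩).2.2
      rw [sub_sub_cancel] at c3
      linarith
    · have c3 := (hleft (r := t + 1) hl ⟨by linarith [ht.1], by linarith⟩).2.2
      rw [add_sub_cancel_right] at c3
      linarith
  have hdisc := discrim_le_zero (a := (q + 2) * (Ir + Il)) (b := -2 * W)
    (c := (q + 2) * (Dr + Dl)) fun l => by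
      rcases le_total 0 l with h | h
      · linarith [young l h]
      · have h1 : 0 ≤ -l * W := mul_nonneg (by linarith) hW0
        have h2 : 0 ≤ (q + 2) * (Ir + Il) * (l * l) :=
          mul_nonneg (mul_nonneg (by linarith) (by linarith)) (mul_self_nonneg l)
        have h3 : 0 ≤ (q + 2) * (Dr + Dl) := mul_nonneg (by linarith) (by linarith)
        linarith
  rw [discrim] at hdisc
  rw [hWsq]
  linarith
end

section
/- Let q ≥ 2 and let g be a smooth complex-valued function on [−1,1] that vanishes in a neighborhood of s = 1 and of s = −1. Then |g(0)|^{q+2} ≤ ((q+2)²/4) · ( ∫_{−1}^{1} |g′(s)|² (1−|s|) ds + |g(0)|² ) · ( ∫_{−1}^{1} |g(s)|^q (1−|s|)^{q/2} ds ). -/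
open MeasureTheory Set

/-- Cauchy–Schwarz inequality for interval integrals of continuous functions. -/
theorem sq_intervalIntegral_mul_le {a b : ℝ} (hab : a ≤ b) {u v : ℝ → ℝ}
    (hu : ContinuousOn u (Icc a b)) (hv : ContinuousOn v (Icc a b)) :
    (∫ s in a..b, u s * v s) ^ 2 ≤ (∫ s in a..b, u s ^ 2) * ∫ s in a..b, v s ^ 2 := by
  have huu : IntervalIntegrable (fun s => u s ^ 2) volume a b :=
    (hu.pow 2).intervalIntegrable_of_Icc hab
  have huv : IntervalIntegrable (fun s => u s * v s) volume a b :=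
    (hu.mul hv).intervalIntegrable_of_Icc hab
  have hvv : IntervalIntegrable (fun s => v s ^ 2) volume a b :=
    (hv.pow 2).intervalIntegrable_of_Icc hab
  have key : ∀ x : ℝ, 0 ≤ (∫ s in a..b, u s ^ 2) * (x * x) +
      (2 * ∫ s in a..b, u s * v s) * x + ∫ s in a..b, v s ^ 2 := by
    intro x
    have h : ∫ s in a..b, (x * u s + v s) ^ 2 = (∫ s in a..b, u s ^ 2) * (x * x) +
        (2 * ∫ s in a..b, u s * v s) * x + ∫ s in a..b, v s ^ 2 := by
      have e : ∀ s, (x * u s + v s) ^ 2 =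
          (x * x) * u s ^ 2 + (2 * x) * (u s * v s) + v s ^ 2 := fun s => by ring
      simp_rw [e]
      rw [intervalIntegral.integral_add ((huu.const_mul _).add (huv.const_mul _)) hvv,
        intervalIntegral.integral_add (huu.const_mul _) (huv.const_mul _),
        intervalIntegral.integral_const_mul, intervalIntegral.integral_const_mul]
      ring
    rw [← h]
    exact intervalIntegral.integral_nonneg hab fun s _ => sq_nonneg _
  have := discrim_le_zero key
  rw [discrim] at this
  linarith

section

variable {E : Type*} [NormedAddCommGroup E] [InnerProductSpace ℝ E] {g g' : ℝ → E}

theorem integral_mul_sq_norm_sub_le (hg : ContinuousOn g (Icc 0 1))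
    (hg' : ContinuousOn g' (Icc 0 1)) (hd : ∀ s ∈ Ioo (0 : ℝ) 1, HasDerivAt g (g' s) s) :
    ∫ s in (0 : ℝ)..1, (1 - s) * ‖(1 - s) • g' s - g s‖ ^ 2 ≤
      (∫ s in (0 : ℝ)..1, ‖g' s‖ ^ 2 * (1 - s)) + ‖g 0‖ ^ 2 := by
  have hF' : IntervalIntegrable (fun s => (2 * (1 - s) * (-1)) * ‖g s‖ ^ 2 +
      (1 - s) ^ 2 * (2 * inner ℝ (g s) (g' s))) volume 0 1 := by
    apply ContinuousOn.intervalIntegrable_of_Icc zero_le_one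
    fun_prop
  have hftc := intervalIntegral.integral_eq_sub_of_hasDerivAt_of_le zero_le_one
    (f := fun s => (1 - s) ^ 2 * ‖g s‖ ^ 2) (by fun_prop) (fun s hs => by
      have h1 : HasDerivAt (fun s : ℝ => (1 - s) ^ 2) (2 * (1 - s) * (-1)) s := by
        simpa using! ((hasDerivAt_id s).const_sub 1).pow 2
      exact h1.mul (hd s hs).norm_sq) hF'
  have hA : IntervalIntegrable (fun s => ‖g' s‖ ^ 2 * (1 - s)) volume 0 1 := by
    apply ContinuousOn.intervalIntegrable_of_Icc zero_le_one
    fun_prop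
  have hL : IntervalIntegrable (fun s => (1 - s) * ‖(1 - s) • g' s - g s‖ ^ 2) volume 0 1 := by
    apply ContinuousOn.intervalIntegrable_of_Icc zero_le_one
    fun_prop
  have hmono := intervalIntegral.integral_mono_on zero_le_one hL (hA.sub hF') fun s hs => by
    have h0 : 0 ≤ 1 - s := by linarith [hs.2]
    have h1 : 1 - s ≤ 1 := by linarith [hs.1]
    have hexp : ‖(1 - s) • g' s - g s‖ ^ 2 =
        (1 - s) ^ 2 * ‖g' s‖ ^ 2 - 2 * (1 - s) * inner ℝ (g s) (g' s) + ‖g s‖ ^ 2 := by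
      rw [norm_sub_sq_real, norm_smul, mul_pow, real_inner_smul_left, real_inner_comm,
        Real.norm_eq_abs, sq_abs]
      ring
    rw [hexp]
    have h2 : (1 - s) ^ 2 ≤ 1 := pow_le_one₀ h0 h1
    have h3 : 0 ≤ ((1 - s) * ‖g' s‖ ^ 2) * (1 - (1 - s) ^ 2) := by
      apply mul_nonneg <;> [positivity; linarith]
    have h4 : 0 ≤ (1 - s) * ‖g s‖ ^ 2 := by positivity
    nlinarith
  rw [intervalIntegral.integral_sub hA hF', hftc] at hmono
  simpa using hmono

theorem norm_rpow_le_integral_of_eq_zero {G G' : ℝ → E} {p : ℝ} (hp : 2 ≤ p) {a b : ℝ}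
    (hab : a ≤ b) (hG : ContinuousOn G (Icc a b)) (hG' : ContinuousOn G' (Icc a b))
    (hd : ∀ s ∈ Ioo a b, HasDerivAt G (G' s) s) (hb : G b = 0) :
    ‖G a‖ ^ p ≤ p * ∫ s in a..b, ‖G s‖ ^ (p - 1) * ‖G' s‖ := by
  have hp0 : 0 < p := by linarith
  have hc : ∀ r : ℝ, 0 ≤ r → ContinuousOn (fun s => ‖G s‖ ^ r) (Icc a b) := fun r hr =>
    hG.norm.rpow_const fun _ _ => Or.inr hr
  have hF' : IntervalIntegrable
      (fun s => (p * ‖G s‖ ^ (p - 2)) * inner ℝ (G s) (G' s)) volume a b :=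
    ((continuousOn_const.mul (hc _ (by linarith))).mul
      (hG.inner hG')).intervalIntegrable_of_Icc hab
  have hftc := intervalIntegral.integral_eq_sub_of_hasDerivAt_of_le hab
    (f := fun s => ‖G s‖ ^ p) (hc p hp0.le) (fun s hs => by
      simpa [Function.comp_def] using (hasFDerivAt_norm_rpow (G s) (by linarith : 1 < p)).comp_hasDerivAt s
        (hd s hs)) hF'
  have hR : IntervalIntegrable (fun s => p * (‖G s‖ ^ (p - 1) * ‖G' s‖)) volume a b :=
    (continuousOn_const.mul ((hc _ (by linarith)).mul hG'.norm)).intervalIntegrable_of_Icc hab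
  have hmono := intervalIntegral.integral_mono_on hab hF'.neg hR fun s _ => by
    have h1 : -inner ℝ (G s) (G' s) ≤ ‖G s‖ * ‖G' s‖ :=
      (neg_le_abs _).trans (abs_real_inner_le_norm _ _)
    have h2 : ‖G s‖ ^ (p - 1) = ‖G s‖ ^ (p - 2) * ‖G s‖ := by
      rw [← Real.rpow_add_one' (norm_nonneg _) (by linarith)]
      ring_nf
    have h3 : 0 ≤ p * ‖G s‖ ^ (p - 2) := by positivity
    rw [h2]
    have := mul_le_mul_of_nonneg_left h1 h3
    simp only [Pi.neg_apply]
    linarith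
  simp only [Pi.neg_apply, intervalIntegral.integral_neg] at hmono
  rw [hftc, intervalIntegral.integral_const_mul, hb, norm_zero, Real.zero_rpow hp0.ne'] at hmono
  linarith

theorem norm_rpow_le_mul_integral_of_hasDerivAt {q : ℝ} (hq : 2 ≤ q)
    (hg : ContinuousOn g (Icc 0 1)) (hg' : ContinuousOn g' (Icc 0 1))
    (hd : ∀ s ∈ Ioo (0 : ℝ) 1, HasDerivAt g (g' s) s) :
    ‖g 0‖ ^ (q + 2) ≤ (q + 2) ^ 2 / 4 *
      ((∫ s in (0 : ℝ)..1, ‖g' s‖ ^ 2 * (1 - s)) + ‖g 0‖ ^ 2) *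
      ∫ s in (0 : ℝ)..1, ‖g s‖ ^ q * (1 - s) ^ (q / 2) := by
  have hw : ∀ r : ℝ, 0 ≤ r → ContinuousOn (fun s : ℝ => (1 - s) ^ r) (Icc 0 1) := fun r hr =>
    (by fun_prop : ContinuousOn (fun s : ℝ => 1 - s) (Icc 0 1)).rpow_const fun _ _ => Or.inr hr
  have hn : ∀ r : ℝ, 0 ≤ r → ContinuousOn (fun s => ‖g s‖ ^ r) (Icc 0 1) := fun r hr =>
    hg.norm.rpow_const fun _ _ => Or.inr hr
  have hsq : ∀ x r : ℝ, 0 ≤ x → (x ^ r) ^ 2 = x ^ (2 * r) := fun x r hx => by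
    rw [← Real.rpow_natCast, ← Real.rpow_mul hx]
    ring_nf
  set u : ℝ → ℝ := fun s => ‖g s‖ ^ (q / 2) * (1 - s) ^ (q / 4) with hu
  set v : ℝ → ℝ := fun s => (1 - s) ^ (q / 4) * ‖(1 - s) • g' s - g s‖ with hv
  have huc : ContinuousOn u (Icc 0 1) := (hn _ (by linarith)).mul (hw _ (by linarith))
  have hG' : ContinuousOn (fun s => (1 - s) • g' s - g s) (Icc 0 1) := by fun_prop
  have hvc : ContinuousOn v (Icc 0 1) := (hw _ (by linarith)).mul hG'.norm
  have h1 := norm_rpow_le_integral_of_eq_zero (G := fun s => (1 - s) • g s)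
    (G' := fun s => (1 - s) • g' s - g s) (p := q / 2 + 1) (by linarith) zero_le_one
    (by fun_prop) hG' (fun s hs => by
      refine (((hasDerivAt_id' s).const_sub 1).smul (hd s hs)).congr_deriv ?_
      simp [sub_eq_add_neg]) (by simp)
  have h2 : ∫ s in (0 : ℝ)..1, ‖(1 - s) • g s‖ ^ (q / 2 + 1 - 1) * ‖(1 - s) • g' s - g s‖ =
      ∫ s in (0 : ℝ)..1, u s * v s := by
    refine intervalIntegral.integral_congr fun s hs => ?_
    rw [uIcc_of_le zero_le_one] at hs
    have h0 : 0 ≤ 1 - s := by linarith [hs.2]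
    have e : (1 - s) ^ (q / 2) = ((1 - s) ^ (q / 4)) ^ 2 := by
      rw [hsq _ _ h0]
      ring_nf
    simp only [hu, hv, add_sub_cancel_right]
    rw [norm_smul, Real.norm_of_nonneg h0, Real.mul_rpow h0 (norm_nonneg _), e]
    ring
  have h3 : ∫ s in (0 : ℝ)..1, u s ^ 2 =
      ∫ s in (0 : ℝ)..1, ‖g s‖ ^ q * (1 - s) ^ (q / 2) := by
    refine intervalIntegral.integral_congr fun s hs => ?_
    rw [uIcc_of_le zero_le_one] at hs
    simp only [hu]
    rw [mul_pow, hsq _ _ (norm_nonneg _), hsq _ _ (by linarith [hs.2])]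
    ring_nf
  have h4 : ∫ s in (0 : ℝ)..1, v s ^ 2 ≤
      (∫ s in (0 : ℝ)..1, ‖g' s‖ ^ 2 * (1 - s)) + ‖g 0‖ ^ 2 := by
    refine le_trans ?_ (integral_mul_sq_norm_sub_le hg hg' hd)
    refine intervalIntegral.integral_mono_on zero_le_one
      ((hvc.pow 2).intervalIntegrable_of_Icc zero_le_one)
      (ContinuousOn.intervalIntegrable_of_Icc zero_le_one (by fun_prop)) fun s hs => ?_
    have h0 : 0 ≤ 1 - s := by linarith [hs.2]
    simp only [hv]
    rw [mul_pow, hsq _ _ h0]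
    gcongr
    simpa using Real.rpow_le_rpow_of_exponent_ge' h0 (by linarith [hs.1]) zero_le_one
      (by linarith : 1 ≤ 2 * (q / 4))
  have h5 := sq_intervalIntegral_mul_le zero_le_one huc hvc
  rw [h2] at h1
  simp only [sub_zero, one_smul] at h1
  have hB : 0 ≤ ∫ s in (0 : ℝ)..1, u s ^ 2 :=
    intervalIntegral.integral_nonneg zero_le_one fun s _ => sq_nonneg _
  calc ‖g 0‖ ^ (q + 2) = (‖g 0‖ ^ (q / 2 + 1)) ^ 2 := by
        rw [hsq _ _ (norm_nonneg _)]
        ring_nf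
    _ ≤ ((q / 2 + 1) * ∫ s in (0 : ℝ)..1, u s * v s) ^ 2 := by gcongr
    _ = (q + 2) ^ 2 / 4 * (∫ s in (0 : ℝ)..1, u s * v s) ^ 2 := by ring
    _ ≤ (q + 2) ^ 2 / 4 * ((∫ s in (0 : ℝ)..1, u s ^ 2) *
          ((∫ s in (0 : ℝ)..1, ‖g' s‖ ^ 2 * (1 - s)) + ‖g 0‖ ^ 2)) := by
        gcongr
        exact h5.trans (by gcongr)
    _ = _ := by
        rw [h3]
        ring

end

theorem intervalIntegral_le_setIntegral_Ioo {f h : ℝ → ℝ} (hf : ContinuousOn f (Icc (-1) 1))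
    (hf0 : ∀ s ∈ Icc (-1 : ℝ) 1, 0 ≤ f s) (hfh : ∀ s ∈ Ioo (0 : ℝ) 1, h s = f s) :
    ∫ s in (0 : ℝ)..1, h s ≤ ∫ s in Ioo (-1 : ℝ) 1, f s := by
  rw [intervalIntegral.integral_of_le zero_le_one, integral_Ioc_eq_integral_Ioo,
    setIntegral_congr_fun measurableSet_Ioo hfh]
  refine setIntegral_mono_set
    ((hf.integrableOn_compact isCompact_Icc).mono_set Ioo_subset_Icc_self) ?_
    (Ioo_subset_Ioo_left (by norm_num)).eventuallyLE
  exact ae_restrict_of_forall_mem measurableSet_Ioo fun s hs => hf0 s (Ioo_subset_Icc_self hs)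

/-- The key weighted one-dimensional inequality (inequality (2.2) in the proof of
Proposition 1): for `q ≥ 2` and a smooth function `g` on `[−1,1]` vanishing in a
neighborhood of `s = 1` and of `s = −1`,
`|g(0)|^{q+2} ≤ ((q+2)²/4) (∫_{−1}^1 |g'|²(1−|s|) ds + |g(0)|²) ∫_{−1}^1 |g|^q (1−|s|)^{q/2} ds`. -/
theorem one_dim_weighted_key (q : ℝ) (hq : 2 ≤ q) (g : ℝ → ℂ)
    (hg : ContDiffOn ℝ (⊤ : ℕ∞) g (Set.Icc (-1) 1))
    (hvan : ∃ ε > 0, ∀ s ∈ Set.Icc (-1 : ℝ) 1, 1 - ε < |s| → g s = 0) :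
    ‖g 0‖ ^ (q + 2) ≤ (q + 2) ^ 2 / 4 *
      ((∫ s in Set.Ioo (-1 : ℝ) 1, ‖deriv g s‖ ^ 2 * (1 - |s|)) + ‖g 0‖ ^ 2) *
      (∫ s in Set.Ioo (-1 : ℝ) 1, ‖g s‖ ^ q * (1 - |s|) ^ (q / 2)) := by
  set D : ℝ → ℂ := derivWithin g (Icc (-1) 1) with hD
  have hgc : ContinuousOn g (Icc (-1) 1) := hg.continuousOn
  have hDc : ContinuousOn D (Icc (-1) 1) :=
    hg.continuousOn_derivWithin (uniqueDiffOn_Icc (by norm_num)) (by simp)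
  have hd : ∀ s ∈ Ioo (-1 : ℝ) 1, HasDerivAt g (D s) s := fun s hs =>
    ((hg.differentiableOn (by simp)) s (Ioo_subset_Icc_self hs)).hasDerivWithinAt.hasDerivAt
      (Icc_mem_nhds hs.1 hs.2)
  have hsub : Icc (0 : ℝ) 1 ⊆ Icc (-1) 1 := Icc_subset_Icc_left (by norm_num)
  have hderiv : ∫ s in Ioo (-1 : ℝ) 1, ‖deriv g s‖ ^ 2 * (1 - |s|) =
      ∫ s in Ioo (-1 : ℝ) 1, ‖D s‖ ^ 2 * (1 - |s|) :=
    setIntegral_congr_fun measurableSet_Ioo fun s hs => by simp only [(hd s hs).deriv]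
  have habs : ∀ s ∈ Icc (-1 : ℝ) 1, 0 ≤ 1 - |s| := fun s hs => by
    linarith [abs_le.2 hs]
  have hA := intervalIntegral_le_setIntegral_Ioo
    (f := fun s => ‖D s‖ ^ 2 * (1 - |s|)) (h := fun s => ‖D s‖ ^ 2 * (1 - s)) (by fun_prop)
    (fun s hs => mul_nonneg (by positivity) (habs s hs))
    (fun s hs => by simp only [abs_of_pos hs.1])
  have hB := intervalIntegral_le_setIntegral_Ioo
    (f := fun s => ‖g s‖ ^ q * (1 - |s|) ^ (q / 2))
    (h := fun s => ‖g s‖ ^ q * (1 - s) ^ (q / 2))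
    ((hgc.norm.rpow_const fun _ _ => Or.inr (by linarith)).mul
      ((by fun_prop : ContinuousOn (fun s : ℝ => 1 - |s|) (Icc (-1) 1)).rpow_const
        fun _ _ => Or.inr (by linarith)))
    (fun s hs => mul_nonneg (by positivity) (Real.rpow_nonneg (habs s hs) _))
    (fun s hs => by simp only [abs_of_pos hs.1])
  have hB0 : 0 ≤ ∫ s in (0 : ℝ)..1, ‖g s‖ ^ q * (1 - s) ^ (q / 2) :=
    intervalIntegral.integral_nonneg zero_le_one fun s hs =>
      mul_nonneg (by positivity) (Real.rpow_nonneg (by linarith [hs.2]) _)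
  have hA0 : 0 ≤ ∫ s in (0 : ℝ)..1, ‖D s‖ ^ 2 * (1 - s) :=
    intervalIntegral.integral_nonneg zero_le_one fun s hs =>
      mul_nonneg (by positivity) (by linarith [hs.2])
  rw [hderiv]
  refine (norm_rpow_le_mul_integral_of_hasDerivAt hq (hgc.mono hsub) (hDc.mono hsub)
    fun s hs => hd s ⟨by linarith [hs.1], hs.2⟩).trans ?_
  have hA1 := hA0.trans hA
  gcongr
end

section
/- Let q ≥ 2. For every open set Ω ⊊ ℝ and every f ∈ C_0^∞(Ω) one has sup_{t ∈ Ω} |f(t)|^{q+2} ≤ (q+2)² · ( ∫_Ω ( |f′(t)|² − |f(t)|²/(4 dist(t, Ω^c)²) ) dt ) · ( ∫_Ω |f(t)|^q dt ). -/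
open MeasureTheory Metric Set

section HalfInterval

open scoped RealInnerProductSpace

/-- Cauchy–Schwarz for interval integrals of continuous functions. -/
lemma integral_mul_le_sqrt_mul {a b : ℝ} (hab : a ≤ b) {u v : ℝ → ℝ}
    (hu : ContinuousOn u (Icc a b)) (hv : ContinuousOn v (Icc a b)) :
    ∫ s in a..b, u s * v s ≤ √((∫ s in a..b, u s ^ 2) * ∫ s in a..b, v s ^ 2) := by
  rw [← uIcc_of_le hab] at hu hv
  have huu : IntervalIntegrable (fun s ↦ u s ^ 2) volume a b := (hu.pow 2).intervalIntegrable
  have hvv : IntervalIntegrable (fun s ↦ v s ^ 2) volume a b := (hv.pow 2).intervalIntegrable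
  have huv : IntervalIntegrable (fun s ↦ u s * v s) volume a b := (hu.mul hv).intervalIntegrable
  have key := discrim_le_zero (a := ∫ s in a..b, u s ^ 2) (b := -2 * ∫ s in a..b, u s * v s)
    (c := ∫ s in a..b, v s ^ 2) fun x ↦ by
      have h : 0 ≤ ∫ s in a..b, ((x * x) * u s ^ 2 + (-2 * x) * (u s * v s) + v s ^ 2) :=
        intervalIntegral.integral_nonneg hab fun s _ ↦ by nlinarith [sq_nonneg (x * u s - v s)]
      rw [intervalIntegral.integral_add ((huu.const_mul _).add (huv.const_mul _)) hvv,
        intervalIntegral.integral_add (huu.const_mul _) (huv.const_mul _),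
        intervalIntegral.integral_const_mul, intervalIntegral.integral_const_mul] at h
      linarith
  apply Real.le_sqrt_of_sq_le
  rw [discrim] at key
  linarith

lemma integral_le_sub_of_le_deriv {a b : ℝ} (hab : a ≤ b) {u u' φ : ℝ → ℝ}
    (hu : ∀ s ∈ Icc a b, HasDerivAt u (u' s) s) (hφ : ContinuousOn φ (Icc a b))
    (hle : ∀ s ∈ Icc a b, φ s ≤ u' s) : ∫ s in a..b, φ s ≤ u b - u a :=
  intervalIntegral.integral_le_sub_of_hasDeriv_right_of_le hab
    (fun s hs ↦ (hu s hs).continuousAt.continuousWithinAt)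
    (fun s hs ↦ (hu s (Ioo_subset_Icc_self hs)).hasDerivWithinAt)
    (hφ.integrableOn_Icc) (fun s hs ↦ hle s (Ioo_subset_Icc_self hs))

lemma hasDerivAt_norm_rpow_comp {f : ℝ → ℂ} {f' : ℂ} {x p : ℝ} (hf : HasDerivAt f f' x)
    (hp : 1 < p) :
    HasDerivAt (fun s ↦ ‖f s‖ ^ p) (p * ‖f x‖ ^ (p - 2) * ⟪f x, f'⟫) x := by
  exact (hasFDerivAt_norm_rpow (f x) hp).comp_hasDerivAt x hf

lemma neg_rpow_mul_norm_le {p : ℝ} (hp : 2 ≤ p) (z w : ℂ) :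
    -(‖z‖ ^ (p - 1) * ‖w‖) ≤ ‖z‖ ^ (p - 2) * ⟪z, w⟫ := by
  have h1 : ‖z‖ ^ (p - 1) = ‖z‖ ^ (p - 2) * ‖z‖ := by
    rw [← Real.rpow_add_one' (norm_nonneg z) (by linarith)]
    ring_nf
  have h2 := neg_le_of_abs_le (abs_real_inner_le_norm z w)
  rw [h1]
  linarith [mul_le_mul_of_nonneg_left h2 (Real.rpow_nonneg (norm_nonneg z) (p - 2))]

lemma rpow_sub_two_mul_sq {p : ℝ} (hp : 2 ≤ p) (z : ℂ) :
    ‖z‖ ^ (p - 2) * ‖z‖ ^ 2 = ‖z‖ ^ p := by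
  rw [← Real.rpow_natCast ‖z‖ 2, ← Real.rpow_add' (norm_nonneg z) (by norm_num; linarith)]
  norm_num

/-- Half-interval estimate away from the endpoint, where `A` is the energy `∫ s ‖dg/ds‖²` of the
ground state representation `F = √s g`. -/
lemma hardy_half_aux {p : ℝ} (hp : 2 ≤ p) {ε a : ℝ} (hε : 0 < ε) (hεa : ε ≤ a) {F F' : ℝ → ℂ}
    (hF : ∀ s, HasDerivAt F (F' s) s) (hF' : Continuous F') (h0 : F ε = 0) :
    ∃ A B : ℝ, 0 ≤ A ∧ B = ∫ s in ε..a, ‖F s‖ ^ (2 * p - 2) ∧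
      ∫ s in ε..a, (‖F' s‖ ^ 2 - ‖F s‖ ^ 2 / (4 * s ^ 2)) = A + ‖F a‖ ^ 2 / (2 * a) ∧
      (∀ t ∈ Icc ε a, ‖F t‖ ^ p ≤ ‖F a‖ ^ p + p * √(B * A)) ∧
      ‖F a‖ ^ p ≤ p * √(B * A) + (1 + p / 2) * √(B * (A + ‖F a‖ ^ 2 / a)) := by
  have hpos : ∀ s ∈ Icc ε a, 0 < s := fun s hs ↦ hε.trans_le hs.1
  have ha : 0 < a := hε.trans_le hεa
  have hFc : Continuous F := continuous_iff_continuousAt.2 fun s ↦ (hF s).continuousAt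
  set D : ℝ → ℂ := fun s ↦ F' s - (1 / (2 * s)) • F s with hD
  have hinv : ContinuousOn (fun s : ℝ ↦ 1 / (2 * s)) (Icc ε a) :=
    continuousOn_const.div (by fun_prop) fun s hs ↦ by have := hpos s hs; positivity
  have hDc : ContinuousOn D (Icc ε a) := hF'.continuousOn.sub (hinv.smul hFc.continuousOn)
  have hF'D : ∀ s, F' s = D s + (1 / (2 * s)) • F s := fun s ↦ by simp [hD]
  have hinner : ∀ s, ⟪F s, F' s⟫ = ⟪F s, D s⟫ + ‖F s‖ ^ 2 / (2 * s) := fun s ↦ by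
    rw [hF'D s, inner_add_right, inner_smul_right, real_inner_self_eq_norm_sq]; ring
  have hsq : ∀ s, ‖F' s‖ ^ 2 = ‖D s‖ ^ 2 + ⟪F s, D s⟫ / s + ‖F s‖ ^ 2 / (4 * s ^ 2) := fun s ↦ by
    rw [hF'D s, norm_add_sq_real, inner_smul_right, norm_smul, real_inner_comm, mul_pow,
      Real.norm_eq_abs, sq_abs]
    ring
  have hpow : Continuous fun s ↦ ‖F s‖ ^ (p - 1) :=
    hFc.norm.rpow_const fun _ ↦ Or.inr (by linarith)
  have hpow2 : ∀ s, (‖F s‖ ^ (p - 1)) ^ 2 = ‖F s‖ ^ (2 * p - 2) := fun s ↦ by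
    rw [← Real.rpow_natCast, ← Real.rpow_mul (norm_nonneg _)]
    norm_num; ring_nf
  have hpow1 : ∀ s, ‖F s‖ ^ (p - 1) * ‖F s‖ = ‖F s‖ ^ p := fun s ↦ by
    rw [← Real.rpow_add_one' (norm_nonneg _) (by linarith)]
    ring_nf
  set A := ∫ s in ε..a, ‖D s‖ ^ 2 with hA
  set B := ∫ s in ε..a, ‖F s‖ ^ (2 * p - 2) with hB
  have hB0 : 0 ≤ B := intervalIntegral.integral_nonneg hεa fun s _ ↦ by positivity
  have hA0 : 0 ≤ A := intervalIntegral.integral_nonneg hεa fun s _ ↦ by positivity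
  have hDi : ∀ t ∈ Icc ε a, IntervalIntegrable (fun s ↦ ‖D s‖ ^ 2) volume t a := fun t ht ↦
    ((hDc.mono (Icc_subset_Icc_left ht.1)).norm.pow 2).intervalIntegrable_of_Icc ht.2
  have hWc : ContinuousOn (fun s ↦ ‖F s‖ ^ (p - 1) * ‖D s‖) (Icc ε a) :=
    hpow.continuousOn.mul hDc.norm
  have hW : ∫ s in ε..a, ‖F s‖ ^ (p - 1) * ‖D s‖ ≤ √(B * A) := by
    simpa only [hpow2] using integral_mul_le_sqrt_mul hεa hpow.continuousOn hDc.norm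
  refine ⟨A, B, hA0, rfl, ?_, ?_, ?_⟩
  · have hc : ContinuousOn (fun s ↦ ⟪F s, D s⟫ / s) (Icc ε a) :=
      (ContinuousOn.inner (𝕜 := ℝ) hFc.continuousOn hDc).div continuousOn_id
        fun s hs ↦ (hpos s hs).ne'
    have h := intervalIntegral.integral_eq_sub_of_hasDerivAt
      (f := fun s ↦ ‖F s‖ ^ 2 / (2 * s)) (f' := fun s ↦ ⟪F s, D s⟫ / s) (a := ε) (b := a)
      (fun s hs ↦ by
        rw [uIcc_of_le hεa] at hs
        have := (hpos s hs).ne'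
        refine ((hF s).norm_sq.div ((hasDerivAt_id' s).const_mul 2)
          (by simpa using this)).congr_deriv ?_
        rw [hinner]
        field_simp
        ring) (hc.intervalIntegrable_of_Icc hεa)
    simp only [hsq, add_sub_cancel_right]
    rw [intervalIntegral.integral_add (hDi ε ⟨le_rfl, hεa⟩) (hc.intervalIntegrable_of_Icc hεa), h,
      h0, ← hA]
    simp
  · intro t ht
    have hsub : Icc t a ⊆ Icc ε a := Icc_subset_Icc_left ht.1
    have h := integral_le_sub_of_le_deriv ht.2 (φ := fun s ↦ -p * (‖F s‖ ^ (p - 1) * ‖D s‖))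
      (fun s _ ↦ hasDerivAt_norm_rpow_comp (hF s) (by linarith : 1 < p))
      (continuousOn_const.mul (hWc.mono hsub)) fun s hs ↦ by
        have h1 := neg_rpow_mul_norm_le hp (F s) (D s)
        have h2 : 0 ≤ ‖F s‖ ^ (p - 2) * (‖F s‖ ^ 2 / (2 * s)) := by
          have := hpos s (hsub hs); positivity
        rw [hinner]
        nlinarith
    rw [intervalIntegral.integral_const_mul] at h
    have hmono : ∫ s in t..a, ‖F s‖ ^ (p - 1) * ‖D s‖ ≤ ∫ s in ε..a, ‖F s‖ ^ (p - 1) * ‖D s‖ :=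
      intervalIntegral.integral_mono_interval ht.1 ht.2 le_rfl
        (Filter.Eventually.of_forall fun s ↦ by simp only [Pi.zero_apply]; positivity)
        (hWc.intervalIntegrable_of_Icc hεa)
    nlinarith
  · have hFi : ∫ s in ε..a, ‖F s‖ ^ 2 ≤ a ^ 2 * (A + ‖F a‖ ^ 2 / a) := by
      have h := integral_le_sub_of_le_deriv hεa (u := fun s ↦ s * ‖F s‖ ^ 2)
        (φ := fun s ↦ ‖F s‖ ^ 2 - a ^ 2 * ‖D s‖ ^ 2)
        (fun s _ ↦ (hasDerivAt_id s).mul (hF s).norm_sq)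
        ((hFc.norm.pow 2).continuousOn.sub (continuousOn_const.mul (hDc.norm.pow 2)))
        fun s hs ↦ by
          have hs0 := hpos s hs
          have h1 := neg_le_of_abs_le (abs_real_inner_le_norm (F s) (D s))
          have h2 : s ^ 2 * ‖D s‖ ^ 2 ≤ a ^ 2 * ‖D s‖ ^ 2 := by
            have := hs.2; gcongr
          have h3 : s * ⟪F s, F' s⟫ = s * ⟪F s, D s⟫ + ‖F s‖ ^ 2 / 2 := by
            rw [hinner]; field_simp
          have h4 := mul_le_mul_of_nonneg_left h1 hs0.le
          simp only [id]
          nlinarith [sq_nonneg (‖F s‖ - s * ‖D s‖)]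
      rw [intervalIntegral.integral_sub (Continuous.intervalIntegrable (by fun_prop) _ _)
        ((hDi ε ⟨le_rfl, hεa⟩).const_mul _), intervalIntegral.integral_const_mul, h0] at h
      have : a ^ 2 * (‖F a‖ ^ 2 / a) = a * ‖F a‖ ^ 2 := by field_simp
      simp at h
      linarith
    have hV : ∫ s in ε..a, ‖F s‖ ^ p ≤ a * √(B * (A + ‖F a‖ ^ 2 / a)) := by
      have h := integral_mul_le_sqrt_mul hεa hpow.continuousOn hFc.norm.continuousOn
      simp only [hpow1, hpow2] at h
      refine h.trans ?_
      rw [← Real.sqrt_sq ha.le, ← Real.sqrt_mul (sq_nonneg a), Real.sqrt_sq ha.le]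
      apply Real.sqrt_le_sqrt
      nlinarith [mul_le_mul_of_nonneg_left hFi hB0]
    have hpc : Continuous fun s ↦ ‖F s‖ ^ p := hFc.norm.rpow_const fun _ ↦ Or.inr (by linarith)
    have hpi := hpc.intervalIntegrable (μ := volume) ε a
    have h := intervalIntegral.integral_mono_on hεa (μ := volume)
      (f := fun s ↦ ‖F s‖ ^ p + s * (p * ‖F s‖ ^ (p - 2) * ⟪F s, F' s⟫))
      (g := fun s ↦ (1 + p / 2) * ‖F s‖ ^ p + p * a * (‖F s‖ ^ (p - 1) * ‖D s‖))
      (Continuous.intervalIntegrable (by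
        have : Continuous fun s ↦ ‖F s‖ ^ (p - 2) :=
          hFc.norm.rpow_const fun _ ↦ Or.inr (by linarith)
        fun_prop) _ _)
      ((hpi.const_mul _).add ((hWc.intervalIntegrable_of_Icc hεa).const_mul _))
      fun s hs ↦ by
        have hs0 := hpos s hs
        have h1 := neg_rpow_mul_norm_le hp (F s) (-D s)
        rw [inner_neg_right, norm_neg] at h1
        have h3 : s * ⟪F s, F' s⟫ = s * ⟪F s, D s⟫ + ‖F s‖ ^ 2 / 2 := by
          rw [hinner]; field_simp
        have h4 : s * (p * ‖F s‖ ^ (p - 2) * ⟪F s, F' s⟫) =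
            p * s * (‖F s‖ ^ (p - 2) * ⟪F s, D s⟫) + p / 2 * ‖F s‖ ^ p := by
          rw [← rpow_sub_two_mul_sq hp]
          linear_combination p * ‖F s‖ ^ (p - 2) * h3
        have h5 : p * s * (‖F s‖ ^ (p - 2) * ⟪F s, D s⟫) ≤ p * s * (‖F s‖ ^ (p - 1) * ‖D s‖) := by
          refine mul_le_mul_of_nonneg_left ?_ (by positivity)
          linarith
        have h6 : p * s * (‖F s‖ ^ (p - 1) * ‖D s‖) ≤ p * a * (‖F s‖ ^ (p - 1) * ‖D s‖) := by
          have := hs.2; gcongr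
        rw [h4]
        linarith
    rw [intervalIntegral.integral_eq_sub_of_hasDerivAt (f := fun s ↦ s * ‖F s‖ ^ p)
        (fun s _ ↦ by
          refine ((hasDerivAt_id' s).mul
            (hasDerivAt_norm_rpow_comp (hF s) (by linarith : 1 < p))).congr_deriv ?_
          rw [one_mul])
        (Continuous.intervalIntegrable (by
          have : Continuous fun s ↦ ‖F s‖ ^ (p - 2) :=
            hFc.norm.rpow_const fun _ ↦ Or.inr (by linarith)
          fun_prop) _ _),
      intervalIntegral.integral_add (hpi.const_mul _)
        ((hWc.intervalIntegrable_of_Icc hεa).const_mul _), intervalIntegral.integral_const_mul,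
      intervalIntegral.integral_const_mul, h0, norm_zero, Real.zero_rpow (by linarith), mul_zero,
      sub_zero] at h
    refine le_of_mul_le_mul_left (h.trans ?_) ha
    have h1 := mul_le_mul_of_nonneg_left hV (by linarith : 0 ≤ 1 + p / 2)
    have h2 := mul_le_mul_of_nonneg_left hW (by positivity : 0 ≤ p * a)
    linarith

end HalfInterval

/-- The half-interval estimate on `[0, a]` for functions vanishing near `0`. -/
lemma hardy_half {p : ℝ} (hp : 2 ≤ p) {a : ℝ} (ha : 0 < a) {F : ℝ → ℂ} (hF : ContDiff ℝ 1 F)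
    (h0 : (0 : ℝ) ∉ tsupport F) :
    ∃ A B : ℝ, 0 ≤ A ∧ B = ∫ s in (0 : ℝ)..a, ‖F s‖ ^ (2 * p - 2) ∧
      ∫ s in (0 : ℝ)..a, (‖deriv F s‖ ^ 2 - ‖F s‖ ^ 2 / (4 * s ^ 2)) = A + ‖F a‖ ^ 2 / (2 * a) ∧
      (∀ t ∈ Icc 0 a, ‖F t‖ ^ p ≤ ‖F a‖ ^ p + p * √(B * A)) ∧
      ‖F a‖ ^ p ≤ p * √(B * A) + (1 + p / 2) * √(B * (A + ‖F a‖ ^ 2 / a)) := by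
  obtain ⟨δ, hδ, hball⟩ := Metric.isOpen_iff.1 (isClosed_tsupport F).isOpen_compl 0 h0
  set ε := min (δ / 2) a with hε
  have hε0 : 0 < ε := lt_min (by linarith) ha
  have hεa : ε ≤ a := min_le_right _ _
  have hnot : ∀ s ∈ Icc 0 ε, s ∉ tsupport F := fun s hs ↦ hball (by
    have : ε ≤ δ / 2 := min_le_left _ _
    rw [Metric.mem_ball, Real.dist_eq, sub_zero, abs_of_nonneg hs.1]
    linarith [hs.2])
  have hz : ∀ s ∈ Icc 0 ε, F s = 0 := fun s hs ↦ image_eq_zero_of_notMem_tsupport (hnot s hs)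
  have hz' : ∀ s ∈ Icc 0 ε, deriv F s = 0 := fun s hs ↦ deriv_of_notMem_tsupport (hnot s hs)
  have hint : ∀ φ : ℝ → ℝ, (∀ s ∈ Icc 0 ε, φ s = 0) →
      ∫ s in (0 : ℝ)..a, φ s = ∫ s in ε..a, φ s := fun φ hφ ↦ by
    rw [intervalIntegral.integral_of_le ha.le, intervalIntegral.integral_of_le hεa]
    refine setIntegral_eq_of_subset_of_forall_sdiff_eq_zero measurableSet_Ioc
      (Ioc_subset_Ioc_left hε0.le) fun s hs ↦ hφ s ⟨hs.1.1.le, ?_⟩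
    by_contra! h
    exact hs.2 ⟨h, hs.1.2⟩
  obtain ⟨A, B, hA, hB, hE, ht, hm⟩ := hardy_half_aux hp hε0 hεa
    (fun s ↦ (hF.differentiable one_ne_zero s).hasDerivAt) (hF.continuous_deriv le_rfl)
    (hz ε ⟨hε0.le, le_rfl⟩)
  refine ⟨A, B, hA, ?_, ?_, fun t hta ↦ ?_, hm⟩
  · rw [hB, hint]
    intro s hs
    rw [hz s hs, norm_zero, Real.zero_rpow (by linarith)]
  · rw [← hE, hint]
    intro s hs
    simp [hz s hs, hz' s hs]
  · rcases le_total ε t with h | h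
    · exact ht t ⟨h, hta.2⟩
    · rw [hz t ⟨hta.1, h⟩, norm_zero, Real.zero_rpow (by linarith)]
      positivity

lemma hardy_sobolev_combine {p AL BL AR BR G T X : ℝ} (hp : 2 ≤ p) (hAL : 0 ≤ AL) (hBL : 0 ≤ BL)
    (hAR : 0 ≤ AR) (hBR : 0 ≤ BR) (hG : 0 ≤ G) (hT : T ≤ X + p * √(BL * AL))
    (hX : X ≤ p * √(BR * AR) + (1 + p / 2) * √(BR * (AR + G))) :
    T ≤ 2 * p * √((AL + AR + G) * (BL + BR)) := by
  have h1 : √(BR * (AR + G)) ≤ √((AL + AR + G) * (BL + BR)) := by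
    apply Real.sqrt_le_sqrt
    nlinarith [mul_nonneg hAL hBL, mul_nonneg hAL hBR, mul_nonneg hAR hBL, mul_nonneg hG hBL]
  have h2 : √(BL * AL) + √(BR * AR) ≤ √((AL + AR + G) * (BL + BR)) := by
    apply Real.le_sqrt_of_sq_le
    rw [Real.sqrt_mul hBL, Real.sqrt_mul hBR]
    have e1 := Real.sq_sqrt hAL
    have e2 := Real.sq_sqrt hBL
    have e3 := Real.sq_sqrt hAR
    have e4 := Real.sq_sqrt hBR
    calc (√BL * √AL + √BR * √AR) ^ 2 ≤ (√AL ^ 2 + √AR ^ 2) * (√BL ^ 2 + √BR ^ 2) := by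
          nlinarith [sq_nonneg (√AL * √BR - √AR * √BL)]
      _ ≤ _ := by rw [e1, e2, e3, e4]; nlinarith [mul_nonneg hG hBL, mul_nonneg hG hBR]
  nlinarith [mul_le_mul_of_nonneg_left h1 (by linarith : 0 ≤ 1 + p / 2),
    mul_le_mul_of_nonneg_left h2 (by linarith : 0 ≤ p),
    mul_le_mul_of_nonneg_right (by linarith : 1 + p / 2 ≤ p)
      (Real.sqrt_nonneg ((AL + AR + G) * (BL + BR)))]

/-- The Hardy–Sobolev inequality on a bounded interval `(b, c)`. -/
lemma hardy_sobolev_interval {p : ℝ} (hp : 2 ≤ p) {b c : ℝ} (hbc : b < c) {f : ℝ → ℂ}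
    (hf : ContDiff ℝ 1 f) (hb : b ∉ tsupport f) (hc : c ∉ tsupport f) {Φ : ℝ → ℝ}
    (hΦi : IntervalIntegrable Φ volume b c)
    (hΦ : ∀ s ∈ Ioo b c, Φ s = ‖deriv f s‖ ^ 2 - ‖f s‖ ^ 2 / (4 * min (s - b) (c - s) ^ 2)) :
    0 ≤ ∫ s in b..c, Φ s ∧ ∀ t ∈ Icc b c,
      ‖f t‖ ^ p ≤ 2 * p * √((∫ s in b..c, Φ s) * ∫ s in b..c, ‖f s‖ ^ (2 * p - 2)) := by
  set a := (c - b) / 2 with ha_def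
  have ha : 0 < a := by linarith
  have hm1 : b + a = c - a := by linarith
  have hL0 : (0 : ℝ) ∉ tsupport fun s ↦ f (b + s) := fun h ↦ hb <| by
    simpa using tsupport_comp_subset_preimage f (f := fun s ↦ b + s) (by fun_prop) h
  have hR0 : (0 : ℝ) ∉ tsupport fun s ↦ f (c - s) := fun h ↦ hc <| by
    simpa using tsupport_comp_subset_preimage f (f := fun s ↦ c - s) (by fun_prop) h
  obtain ⟨AL, BL, hAL, hBL, hEL, htL, hmL⟩ := hardy_half hp ha (F := fun s ↦ f (b + s))
    (hf.comp (by fun_prop)) hL0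
  obtain ⟨AR, BR, hAR, hBR, hER, htR, hmR⟩ := hardy_half hp ha (F := fun s ↦ f (c - s))
    (hf.comp (by fun_prop)) hR0
  have hBL0 : 0 ≤ BL := hBL ▸ intervalIntegral.integral_nonneg ha.le fun s _ ↦ by positivity
  have hBR0 : 0 ≤ BR := hBR ▸ intervalIntegral.integral_nonneg ha.le fun s _ ↦ by positivity
  have hsplit : ∀ φ : ℝ → ℝ, IntervalIntegrable φ volume b c → ∫ s in b..c, φ s =
      (∫ s in (0 : ℝ)..a, φ (b + s)) + ∫ s in (0 : ℝ)..a, φ (c - s) := fun φ hφ ↦ by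
    have hmem : b + a ∈ uIcc b c := by rw [uIcc_of_le hbc.le]; constructor <;> linarith
    rw [intervalIntegral.integral_comp_add_left, intervalIntegral.integral_comp_sub_left,
      add_zero, sub_zero, ← hm1]
    exact (intervalIntegral.integral_add_adjacent_intervals
      (hφ.mono_set (uIcc_subset_uIcc_left hmem)) (hφ.mono_set (uIcc_subset_uIcc_right hmem))).symm
  have hE : ∫ s in b..c, Φ s = AL + AR + ‖f (b + a)‖ ^ 2 / a := by
    have e1 : ∫ s in (0 : ℝ)..a, Φ (b + s) = AL + ‖f (b + a)‖ ^ 2 / (2 * a) := by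
      rw [← hEL]
      rw [intervalIntegral.integral_of_le ha.le, intervalIntegral.integral_of_le ha.le]
      refine setIntegral_congr_fun measurableSet_Ioc fun s hs ↦ ?_
      have : min (b + s - b) (c - (b + s)) = s := by
        rw [min_eq_left] <;> linarith [hs.2]
      rw [hΦ _ ⟨by linarith [hs.1], by linarith [hs.2]⟩, this, deriv_comp_const_add]
    have e2 : ∫ s in (0 : ℝ)..a, Φ (c - s) = AR + ‖f (c - a)‖ ^ 2 / (2 * a) := by
      rw [← hER]
      rw [intervalIntegral.integral_of_le ha.le, intervalIntegral.integral_of_le ha.le]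
      refine setIntegral_congr_fun measurableSet_Ioc fun s hs ↦ ?_
      have : min (c - s - b) (c - (c - s)) = s := by
        rw [min_eq_right] <;> linarith [hs.2]
      rw [hΦ _ ⟨by linarith [hs.2], by linarith [hs.1]⟩, this, deriv_comp_const_sub, norm_neg]
    rw [hsplit Φ hΦi, e1, e2, ← hm1]
    field_simp
    ring
  have hBc : Continuous fun s ↦ ‖f s‖ ^ (2 * p - 2) :=
    hf.continuous.norm.rpow_const fun _ ↦ Or.inr (by linarith)
  have hB : ∫ s in b..c, ‖f s‖ ^ (2 * p - 2) = BL + BR := by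
    rw [hsplit _ (hBc.intervalIntegrable _ _), hBL, hBR]
  have hG : 0 ≤ ‖f (b + a)‖ ^ 2 / a := by positivity
  simp only [← hm1] at htR hmR
  refine ⟨by rw [hE]; positivity, fun t ht ↦ ?_⟩
  rw [hE, hB]
  rcases le_total t (b + a) with h | h
  · have h1 := htL (t - b) ⟨by linarith [ht.1], by linarith⟩
    simp only [add_sub_cancel] at h1
    exact hardy_sobolev_combine hp hAL hBL0 hAR hBR0 hG h1 hmR
  · have h1 := htR (c - t) ⟨by linarith [ht.2], by linarith⟩
    simp only [sub_sub_cancel] at h1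
    rw [add_comm AL, add_comm BL]
    exact hardy_sobolev_combine hp hAR hBR0 hAL hBL0 hG h1 hmL

lemma infDist_compl_eq_min {b₀ c₀ s : ℝ} {Ω : Set ℝ} (hb : b₀ ∉ Ω) (hc : c₀ ∉ Ω)
    (h : Ioo b₀ c₀ ⊆ Ω) (hs : s ∈ Ioo b₀ c₀) :
    infDist s Ωᶜ = min (s - b₀) (c₀ - s) := by
  apply le_antisymm
  · refine le_min ?_ ?_
    · simpa [Real.dist_eq, abs_of_pos (sub_pos.2 hs.1)] using
        infDist_le_dist_of_mem (x := s) (mem_compl hb)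
    · simpa [Real.dist_eq, abs_sub_comm s, abs_of_pos (sub_pos.2 hs.2)] using
        infDist_le_dist_of_mem (x := s) (mem_compl hc)
  · refine (le_infDist ⟨b₀, hb⟩).2 fun y hy ↦ ?_
    rw [Real.dist_eq]
    by_cases h1 : b₀ < y
    · have h2 : c₀ ≤ y := by
        by_contra! h2
        exact hy (h ⟨h1, h2⟩)
      rw [abs_sub_comm]
      exact (min_le_right _ _).trans ((by linarith : c₀ - s ≤ y - s).trans (le_abs_self _))
    · exact (min_le_left _ _).trans ((by linarith : s - b₀ ≤ s - y).trans (le_abs_self _))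

lemma infDist_compl_eq_left {b₀ s : ℝ} {Ω : Set ℝ} (hb : b₀ ∉ Ω) (h : Ioi b₀ ⊆ Ω) (hs : b₀ < s) :
    infDist s Ωᶜ = s - b₀ := by
  apply le_antisymm
  · simpa [Real.dist_eq, abs_of_pos (sub_pos.2 hs)] using
      infDist_le_dist_of_mem (x := s) (mem_compl hb)
  · refine (le_infDist ⟨b₀, hb⟩).2 fun y hy ↦ ?_
    have h1 : y ≤ b₀ := not_lt.1 fun h1 ↦ hy (h h1)
    rw [Real.dist_eq]
    exact (by linarith : s - b₀ ≤ s - y).trans (le_abs_self _)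

lemma infDist_compl_eq_right {c₀ s : ℝ} {Ω : Set ℝ} (hc : c₀ ∉ Ω) (h : Iio c₀ ⊆ Ω) (hs : s < c₀) :
    infDist s Ωᶜ = c₀ - s := by
  apply le_antisymm
  · simpa [Real.dist_eq, abs_sub_comm s, abs_of_pos (sub_pos.2 hs)] using
      infDist_le_dist_of_mem (x := s) (mem_compl hc)
  · refine (le_infDist ⟨c₀, hc⟩).2 fun y hy ↦ ?_
    have h1 : c₀ ≤ y := not_lt.1 fun h1 ↦ hy (h h1)
    rw [Real.dist_eq, abs_sub_comm]
    exact (by linarith : c₀ - s ≤ y - s).trans (le_abs_self _)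

lemma connectedComponentIn_eq_of_ordConnected {Ω I : Set ℝ} {x : ℝ} (hI : I.OrdConnected)
    (hx : x ∈ I) (hIΩ : I ⊆ Ω) (hmax : ∀ y ∈ Ω, uIcc x y ⊆ Ω → y ∈ I) :
    connectedComponentIn Ω x = I := by
  refine Subset.antisymm (fun y hy ↦ ?_)
    (hI.isPreconnected.subset_connectedComponentIn hx hIΩ)
  have hord : (connectedComponentIn Ω x).OrdConnected :=
    isPreconnected_connectedComponentIn.ordConnected
  exact hmax y (connectedComponentIn_subset _ _ hy)
    ((hord.uIcc_subset (mem_connectedComponentIn (hIΩ hx)) hy).trans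
      (connectedComponentIn_subset _ _))

lemma exists_left_endpoint {Ω : Set ℝ} (hΩ : IsOpen Ω) {x : ℝ} (hx : x ∈ Ω)
    (h : (Ωᶜ ∩ Iic x).Nonempty) : ∃ b₀ < x, b₀ ∉ Ω ∧ Ioc b₀ x ⊆ Ω := by
  have hbdd : BddAbove (Ωᶜ ∩ Iic x) := ⟨x, fun _ hy ↦ hy.2⟩
  have hmem := (hΩ.isClosed_compl.inter isClosed_Iic).csSup_mem h hbdd
  refine ⟨_, lt_of_le_of_ne hmem.2 fun he ↦ hmem.1 (by rwa [he]), hmem.1, fun y hy ↦ ?_⟩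
  by_contra hy'
  exact hy.1.not_ge (le_csSup hbdd ⟨hy', hy.2⟩)

lemma exists_right_endpoint {Ω : Set ℝ} (hΩ : IsOpen Ω) {x : ℝ} (hx : x ∈ Ω)
    (h : (Ωᶜ ∩ Ici x).Nonempty) : ∃ c₀ > x, c₀ ∉ Ω ∧ Ico x c₀ ⊆ Ω := by
  have hbdd : BddBelow (Ωᶜ ∩ Ici x) := ⟨x, fun _ hy ↦ hy.2⟩
  have hmem := (hΩ.isClosed_compl.inter isClosed_Ici).csInf_mem h hbdd
  refine ⟨_, lt_of_le_of_ne hmem.2 fun he ↦ hmem.1 (he ▸ hx), hmem.1, fun y hy ↦ ?_⟩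
  by_contra hy'
  exact hy.2.not_ge (csInf_le hbdd ⟨hy', hy.1⟩)

/-- On a compact subset `K` of `Ω`, the distance to the complement within a component of `Ω` is
the distance to the endpoints of a suitable bounded interval. -/
lemma exists_interval_of_connectedComponentIn {Ω K : Set ℝ} (hΩ : IsOpen Ω) (hne : Ω ≠ univ)
    (hK : IsCompact K) (hKΩ : K ⊆ Ω) {x : ℝ} (hx : x ∈ Ω) :
    ∃ b c : ℝ, b < c ∧ b ∉ K ∧ c ∉ K ∧ Ioo b c ⊆ connectedComponentIn Ω x ∧
      ∀ s ∈ connectedComponentIn Ω x ∩ K, s ∈ Ioo b c ∧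
        infDist s Ωᶜ = min (s - b) (c - s) := by
  obtain ⟨R, hR⟩ := hK.isBounded.subset_closedBall 0
  have hKR : ∀ s ∈ K, -R ≤ s ∧ s ≤ R := fun s hs ↦ by
    have := hR hs
    rwa [mem_closedBall, Real.dist_eq, sub_zero, abs_le] at this
  by_cases hl : (Ωᶜ ∩ Iic x).Nonempty <;> by_cases hr : (Ωᶜ ∩ Ici x).Nonempty
  · obtain ⟨b, hbx, hb, hbΩ⟩ := exists_left_endpoint hΩ hx hl
    obtain ⟨c, hcx, hc, hcΩ⟩ := exists_right_endpoint hΩ hx hr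
    have hI : Ioo b c ⊆ Ω := fun y hy ↦ (le_total y x).elim (fun h ↦ hbΩ ⟨hy.1, h⟩)
      fun h ↦ hcΩ ⟨h, hy.2⟩
    have hC : connectedComponentIn Ω x = Ioo b c := by
      refine connectedComponentIn_eq_of_ordConnected ordConnected_Ioo ⟨hbx, hcx⟩ hI
        fun y _ hxy ↦ ⟨?_, ?_⟩
      · by_contra! h
        exact hb (hxy (by rw [mem_uIcc]; exact Or.inr ⟨h, hbx.le⟩))
      · by_contra! h
        exact hc (hxy (by rw [mem_uIcc]; exact Or.inl ⟨hcx.le, h⟩))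
    rw [hC]
    exact ⟨b, c, hbx.trans hcx, fun h ↦ hb (hKΩ h), fun h ↦ hc (hKΩ h), Subset.rfl,
      fun s hs ↦ ⟨hs.1, infDist_compl_eq_min hb hc hI hs.1⟩⟩
  · obtain ⟨b, hbx, hb, hbΩ⟩ := exists_left_endpoint hΩ hx hl
    have hI : Ioi b ⊆ Ω := fun y hy ↦ (le_total y x).elim (fun h ↦ hbΩ ⟨hy, h⟩)
      fun h ↦ by_contra fun hn ↦ hr ⟨y, hn, h⟩
    have hC : connectedComponentIn Ω x = Ioi b := by
      refine connectedComponentIn_eq_of_ordConnected ordConnected_Ioi hbx hI fun y _ hxy ↦ ?_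
      by_contra h
      exact hb (hxy (by rw [mem_uIcc]; exact Or.inr ⟨not_lt.1 h, hbx.le⟩))
    have hc1 : b < max (b + 1) (2 * R - b + 1) := lt_max_of_lt_left (by linarith)
    have hc2 : ∀ s ∈ K, b < s → 2 * s - b < max (b + 1) (2 * R - b + 1) := fun s hs _ ↦
      lt_max_of_lt_right (by linarith [(hKR s hs).2])
    rw [hC]
    refine ⟨b, _, hc1, fun h ↦ hb (hKΩ h), fun h ↦ ?_, Ioo_subset_Ioi_self, fun s hs ↦ ?_⟩
    · linarith [hc2 _ h hc1]
    · have h1 : b < s := hs.1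
      have h2 := hc2 s hs.2 h1
      refine ⟨⟨h1, by linarith⟩, ?_⟩
      rw [infDist_compl_eq_left hb hI h1, min_eq_left (by linarith)]
  · obtain ⟨c, hcx, hc, hcΩ⟩ := exists_right_endpoint hΩ hx hr
    have hI : Iio c ⊆ Ω := fun y hy ↦ (le_total x y).elim (fun h ↦ hcΩ ⟨h, hy⟩)
      fun h ↦ by_contra fun hn ↦ hl ⟨y, hn, h⟩
    have hC : connectedComponentIn Ω x = Iio c := by
      refine connectedComponentIn_eq_of_ordConnected ordConnected_Iio hcx hI fun y _ hxy ↦ ?_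
      by_contra h
      exact hc (hxy (by rw [mem_uIcc]; exact Or.inl ⟨hcx.le, not_lt.1 h⟩))
    have hb1 : min (c - 1) (-2 * R - c - 1) < c := min_lt_of_left_lt (by linarith)
    have hb2 : ∀ s ∈ K, s < c → min (c - 1) (-2 * R - c - 1) < 2 * s - c := fun s hs _ ↦
      min_lt_of_right_lt (by linarith [(hKR s hs).1])
    rw [hC]
    refine ⟨_, c, hb1, fun h ↦ ?_, fun h ↦ hc (hKΩ h), Ioo_subset_Iio_self, fun s hs ↦ ?_⟩
    · linarith [hb2 _ h hb1]
    · have h1 : s < c := hs.1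
      have h2 := hb2 s hs.2 h1
      refine ⟨⟨by linarith, h1⟩, ?_⟩
      rw [infDist_compl_eq_right hc hI h1, min_eq_right (by linarith)]
  · refine absurd (eq_univ_of_forall fun y ↦ ?_) hne
    by_contra hy
    exact (le_total y x).elim (fun h ↦ hl ⟨y, hy, h⟩) fun h ↦ hr ⟨y, hy, h⟩

lemma countable_range_connectedComponentIn {Ω : Set ℝ} (hΩ : IsOpen Ω) :
    (range fun x : Ω ↦ connectedComponentIn Ω (x : ℝ)).Countable ∧
    (range fun x : Ω ↦ connectedComponentIn Ω (x : ℝ)).PairwiseDisjoint id := by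
  have hd : (range fun x : Ω ↦ connectedComponentIn Ω (x : ℝ)).PairwiseDisjoint id := by
    rintro _ ⟨x, rfl⟩ _ ⟨y, rfl⟩ hxy
    refine disjoint_left.2 fun z hzx hzy ↦ hxy ?_
    exact (connectedComponentIn_eq hzx).trans (connectedComponentIn_eq hzy).symm
  refine ⟨hd.countable_of_isOpen ?_ ?_, hd⟩
  · rintro _ ⟨x, rfl⟩
    exact hΩ.connectedComponentIn
  · rintro _ ⟨x, rfl⟩
    exact ⟨x, mem_connectedComponentIn x.2⟩

/-- If `Φ` has nonnegative integral over each connected component of `Ω`, each of these integrals is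
at most the integral over `Ω`. -/
lemma setIntegral_connectedComponentIn_le {Ω : Set ℝ} (hΩ : IsOpen Ω) {Φ : ℝ → ℝ}
    (hΦ : IntegrableOn Φ Ω) (h0 : ∀ x ∈ Ω, 0 ≤ ∫ s in connectedComponentIn Ω x, Φ s)
    {x : ℝ} (hx : x ∈ Ω) :
    ∫ s in connectedComponentIn Ω x, Φ s ≤ ∫ s in Ω, Φ s := by
  set 𝒞 := range fun x : Ω ↦ connectedComponentIn Ω (x : ℝ) with h𝒞
  obtain ⟨hcount, hdisj⟩ := countable_range_connectedComponentIn hΩ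
  have : Countable 𝒞 := hcount
  have hU : ⋃ C : 𝒞, (C : Set ℝ) = Ω := by
    refine Subset.antisymm (iUnion_subset ?_) fun y hy ↦ mem_iUnion.2
      ⟨⟨_, ⟨⟨y, hy⟩, rfl⟩⟩, mem_connectedComponentIn hy⟩
    rintro ⟨_, y, rfl⟩
    exact connectedComponentIn_subset _ _
  have hsum := hasSum_integral_iUnion (μ := volume) (f := Φ) (s := fun C : 𝒞 ↦ (C : Set ℝ))
    (by rintro ⟨_, y, rfl⟩; exact hΩ.connectedComponentIn.measurableSet)
    (hdisj.subtype _ _) (by rwa [hU])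
  rw [hU] at hsum
  refine le_hasSum hsum ⟨_, ⟨⟨x, hx⟩, rfl⟩⟩ ?_
  rintro ⟨_, y, rfl⟩ _
  exact h0 y y.2

/-- **One-dimensional Hardy–Sobolev inequality on open sets** (Corollary 1): for `q ≥ 2`,
every open set `Ω ⊊ ℝ` and every `f ∈ C_0^∞(Ω)`,
`sup_{t∈Ω} |f(t)|^{q+2} ≤ (q+2)² (∫_Ω (|f'|² − |f|²/(4 dist(t,Ωᶜ)²)) dt) (∫_Ω |f|^q dt)`. -/
theorem one_dim_hardy_sobolev_open (q : ℝ) (hq : 2 ≤ q) (Ω : Set ℝ) (hΩ : IsOpen Ω)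
    (hne : Ω ≠ Set.univ) (f : ℝ → ℂ) (hf : ContDiff ℝ (⊤ : ℕ∞) f)
    (hsupp : HasCompactSupport f) (hsub : tsupport f ⊆ Ω) :
    ∀ t ∈ Ω, ‖f t‖ ^ (q + 2) ≤ (q + 2) ^ 2 *
      (∫ s in Ω, (‖deriv f s‖ ^ 2 - ‖f s‖ ^ 2 / (4 * Metric.infDist s Ωᶜ ^ 2))) *
      (∫ s in Ω, ‖f s‖ ^ q) := by
  intro t ht
  have hf1 : ContDiff ℝ 1 f := hf.of_le (by exact_mod_cast le_top)
  obtain ⟨p, rfl⟩ : ∃ p, q = 2 * p - 2 := ⟨(q + 2) / 2, by ring⟩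
  have hp : 2 ≤ p := by linarith
  set Φ : ℝ → ℝ := fun s ↦ ‖deriv f s‖ ^ 2 - ‖f s‖ ^ 2 / (4 * infDist s Ωᶜ ^ 2) with hΦ
  have hf0 : ∀ s ∉ tsupport f, f s = 0 := fun s hs ↦ image_eq_zero_of_notMem_tsupport hs
  have hΦ0 : ∀ s ∉ tsupport f, Φ s = 0 := fun s hs ↦ by
    simp [hΦ, hf0 s hs, deriv_of_notMem_tsupport hs]
  have hΦi : Integrable Φ := by
    refine IntegrableOn.integrable_of_forall_notMem_eq_zero (s := tsupport f)
      (ContinuousOn.integrableOn_compact hsupp ?_) hΦ0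
    refine ((hf1.continuous_deriv le_rfl).norm.pow 2).continuousOn.sub
      ((hf.continuous.norm.pow 2).continuousOn.div
        (continuous_const.mul ((continuous_infDist_pt _).pow 2)).continuousOn fun s hs ↦ ?_)
    have : 0 < infDist s Ωᶜ := (hΩ.isClosed_compl.notMem_iff_infDist_pos
      (nonempty_compl.2 hne)).1 (not_not_intro (hsub hs))
    positivity
  have hBi : Integrable fun s ↦ ‖f s‖ ^ (2 * p - 2) :=
    (hf.continuous.norm.rpow_const fun _ ↦ Or.inr (by linarith)).integrable_of_hasCompactSupport
      (hsupp.norm.comp_left (g := fun r : ℝ ↦ r ^ (2 * p - 2)) (Real.zero_rpow (by linarith)))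
  have hloc : ∀ x ∈ Ω, 0 ≤ ∫ s in connectedComponentIn Ω x, Φ s ∧
      ‖f x‖ ^ p ≤ 2 * p * √((∫ s in connectedComponentIn Ω x, Φ s) *
        ∫ s in Ω, ‖f s‖ ^ (2 * p - 2)) := by
    intro x hx
    obtain ⟨b, c, hbc, hb, hc, hsubC, hC⟩ :=
      exists_interval_of_connectedComponentIn hΩ hne hsupp hsub hx
    have hE : ∫ s in connectedComponentIn Ω x, Φ s = ∫ s in b..c, Φ s := by
      rw [intervalIntegral.integral_of_le hbc.le, integral_Ioc_eq_integral_Ioo]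
      refine setIntegral_eq_of_subset_of_forall_sdiff_eq_zero
        hΩ.connectedComponentIn.measurableSet hsubC fun s hs ↦ hΦ0 s fun hsK ↦ ?_
      exact hs.2 (hC s ⟨hs.1, hsK⟩).1
    have hB : ∫ s in b..c, ‖f s‖ ^ (2 * p - 2) ≤ ∫ s in Ω, ‖f s‖ ^ (2 * p - 2) := by
      rw [intervalIntegral.integral_of_le hbc.le, integral_Ioc_eq_integral_Ioo]
      exact setIntegral_mono_set hBi.integrableOn
        (Filter.Eventually.of_forall fun s ↦ by simp only [Pi.zero_apply]; positivity)
        (hsubC.trans (connectedComponentIn_subset _ _)).eventuallyLE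
    obtain ⟨h0, h1⟩ := hardy_sobolev_interval hp hbc hf1 hb hc hΦi.intervalIntegrable
      fun s hs ↦ by
        by_cases hsK : s ∈ tsupport f
        · rw [← (hC s ⟨hsubC hs, hsK⟩).2]
        · rw [hΦ0 s hsK, hf0 s hsK, deriv_of_notMem_tsupport hsK]
          simp
    rw [hE]
    refine ⟨h0, ?_⟩
    by_cases hxK : x ∈ tsupport f
    · refine (h1 x (Ioo_subset_Icc_self (hC x ⟨mem_connectedComponentIn hx, hxK⟩).1)).trans ?_
      gcongr
    · rw [hf0 x hxK, norm_zero, Real.zero_rpow (by linarith)]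
      positivity
  have hEle := setIntegral_connectedComponentIn_le hΩ hΦi.integrableOn (fun x hx ↦ (hloc x hx).1) ht
  have hE0 := (hloc t ht).1.trans hEle
  have hB0 : 0 ≤ ∫ s in Ω, ‖f s‖ ^ (2 * p - 2) := integral_nonneg fun s ↦ by positivity
  have hfin : ‖f t‖ ^ p ≤ 2 * p * √((∫ s in Ω, Φ s) * ∫ s in Ω, ‖f s‖ ^ (2 * p - 2)) :=
    (hloc t ht).2.trans (by gcongr)
  calc ‖f t‖ ^ (2 * p - 2 + 2) = (‖f t‖ ^ p) ^ 2 := by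
        rw [← Real.rpow_natCast, ← Real.rpow_mul (norm_nonneg _)]
        norm_num; ring_nf
    _ ≤ (2 * p * √((∫ s in Ω, Φ s) * ∫ s in Ω, ‖f s‖ ^ (2 * p - 2))) ^ 2 := by gcongr
    _ = _ := by
        rw [mul_pow, Real.sq_sqrt (mul_nonneg hE0 hB0)]
        ring
end

section
/- Let q ≥ p ≥ 2. There exists a constant C_{p,q} > 0 such that for every f ∈ C_0^∞(−1, 1) and every t ∈ [−1, 1], one has |f(t)|^{q(p−1)+p} ≤ C_{p,q} · ( ∫_{−1}^{1} ( |f′(s)|^p − ((p−1)/p)^p |f(s)|^p/(1−|s|)^p ) ds ) · ( ∫_{−1}^{1} |f(s)|^q ds )^{p−1}. -/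
open MeasureTheory Set

section NormInequalities

lemma Real.sq_rpow_half {y : ℝ} (hy : 0 ≤ y) (p : ℝ) : (y ^ 2) ^ (p / 2) = y ^ p := by
  rw [← Real.rpow_natCast y 2, ← Real.rpow_mul hy]; congr 1; push_cast; ring

variable {E : Type*} [NormedAddCommGroup E] [InnerProductSpace ℝ E]

/-- First-order convexity inequality for the `p`-th power of a Hilbert norm. -/
lemma norm_rpow_add_inner_le_norm_add_rpow {p : ℝ} (hp : 2 ≤ p) (a b : E) :
    ‖a‖ ^ p + p * (‖a‖ ^ (p - 2) * inner ℝ a b) ≤ ‖a + b‖ ^ p := by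
  rcases eq_or_ne a 0 with rfl | ha
  · simp only [norm_zero, inner_zero_left, mul_zero, add_zero, zero_add]
    rw [Real.zero_rpow (by linarith)]
    positivity
  have hn : 0 < ‖a‖ := norm_pos_iff.2 ha
  have hsq := norm_add_sq_real a b
  set x := (2 * inner ℝ a b + ‖b‖ ^ 2) / ‖a‖ ^ 2 with hx
  have hx1 : ‖a‖ ^ 2 * (1 + x) = ‖a + b‖ ^ 2 := by
    rw [hx, hsq]; field_simp; ring
  have hx0 : 0 ≤ 1 + x := by
    have : 0 ≤ ‖a‖ ^ 2 * (1 + x) := by rw [hx1]; positivity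
    exact nonneg_of_mul_nonneg_right this (by positivity)
  have hB := one_add_mul_self_le_rpow_one_add (s := x) (by linarith) (p := p / 2) (by linarith)
  have hsplit : ‖a‖ ^ p = ‖a‖ ^ (p - 2) * ‖a‖ ^ 2 := by
    rw [← Real.rpow_natCast ‖a‖ 2, ← Real.rpow_add hn]; congr 1; push_cast; ring
  calc ‖a‖ ^ p + p * (‖a‖ ^ (p - 2) * inner ℝ a b)
      ≤ ‖a‖ ^ p + p * (‖a‖ ^ (p - 2) * inner ℝ a b) + p / 2 * (‖a‖ ^ (p - 2) * ‖b‖ ^ 2) := by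
        have : 0 ≤ p / 2 * (‖a‖ ^ (p - 2) * ‖b‖ ^ 2) := by positivity
        linarith
    _ = ‖a‖ ^ p * (1 + p / 2 * x) := by
        rw [hsplit, hx]; field_simp; ring
    _ ≤ ‖a‖ ^ p * (1 + x) ^ (p / 2) := by gcongr
    _ = ‖a + b‖ ^ p := by
        rw [← Real.sq_rpow_half (norm_nonneg a), ← Real.mul_rpow (by positivity) hx0, hx1,
          Real.sq_rpow_half (norm_nonneg _)]

/-- Clarkson's inequality in a Hilbert space. -/
lemma clarkson_norm_rpow {p : ℝ} (hp : 2 ≤ p) (a b : E) :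
    2 * (‖a‖ ^ p + ‖b‖ ^ p) ≤ ‖a + b‖ ^ p + ‖a - b‖ ^ p := by
  have h1 := Real.add_rpow_le_rpow_add (sq_nonneg ‖a‖) (sq_nonneg ‖b‖) (p := p / 2)
    (by linarith)
  have h2 := (convexOn_rpow (p := p / 2) (by linarith)).2 (x := ‖a + b‖ ^ 2)
    (y := ‖a - b‖ ^ 2) (mem_Ici.2 (by positivity)) (mem_Ici.2 (by positivity))
    (by norm_num : (0 : ℝ) ≤ 1 / 2) (by norm_num : (0 : ℝ) ≤ 1 / 2) (by norm_num)
  simp only [smul_eq_mul] at h2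
  have h3 : 1 / 2 * ‖a + b‖ ^ 2 + 1 / 2 * ‖a - b‖ ^ 2 = ‖a‖ ^ 2 + ‖b‖ ^ 2 := by
    rw [norm_add_sq_real, norm_sub_sq_real]; ring
  rw [h3] at h2
  simp only [Real.sq_rpow_half (norm_nonneg _)] at h1 h2
  linarith

/-- Quantitative convexity of the `p`-th power of a Hilbert norm, for `p ≥ 2`. -/
lemma norm_rpow_add_inner_add_le_norm_add_rpow {p : ℝ} (hp : 2 ≤ p) (a b : E) :
    ‖a‖ ^ p + p * (‖a‖ ^ (p - 2) * inner ℝ a b) + 2 * (1 / 2) ^ p * ‖b‖ ^ p ≤ ‖a + b‖ ^ p := by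
  have h1 := norm_rpow_add_inner_le_norm_add_rpow hp a ((1 / 2 : ℝ) • b)
  have h2 := clarkson_norm_rpow hp (a + (1 / 2 : ℝ) • b) ((1 / 2 : ℝ) • b)
  have h3 : a + (1 / 2 : ℝ) • b + (1 / 2 : ℝ) • b = a + b := by
    rw [add_assoc, ← add_smul]; norm_num
  have h4 : ‖(1 / 2 : ℝ) • b‖ ^ p = (1 / 2) ^ p * ‖b‖ ^ p := by
    rw [norm_smul, Real.mul_rpow (norm_nonneg _) (norm_nonneg _)]; norm_num
  rw [h3, h4, add_sub_cancel_right] at h2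
  rw [inner_smul_right] at h1
  linarith

end NormInequalities

lemma ContinuousOn.memLp_restrict_Ioc {a b : ℝ} {F : ℝ → ℝ} (hF : ContinuousOn F (Icc a b))
    (r : ENNReal) : MemLp F r (volume.restrict (Ioc a b)) := by
  obtain ⟨M, hM⟩ := isCompact_Icc.exists_bound_of_continuousOn hF
  refine MemLp.of_bound ((hF.mono Ioc_subset_Icc_self).aestronglyMeasurable measurableSet_Ioc) M ?_
  exact (ae_restrict_iff' measurableSet_Ioc).2
    (Filter.Eventually.of_forall fun x hx => hM x (Ioc_subset_Icc_self hx))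

/-- Hölder's inequality on an interval, in the form adapted to `F ^ (q (p - 1) / p) * W`. -/
lemma integral_rpow_mul_le {p q b : ℝ} (hp : 2 ≤ p) (hq : 0 < q) (hb : 0 ≤ b) {F W : ℝ → ℝ}
    (hF : ContinuousOn F (Icc 0 b)) (hW : ContinuousOn W (Icc 0 b))
    (hF0 : ∀ s ∈ Icc 0 b, 0 ≤ F s) (hW0 : ∀ s ∈ Icc 0 b, 0 ≤ W s) :
    ∫ s in (0)..b, F s ^ (q * ((p - 1) / p)) * W s ≤
      (∫ s in (0)..b, F s ^ q) ^ ((p - 1) / p) * (∫ s in (0)..b, W s ^ p) ^ (1 / p) := by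
  have hp0 : 0 < p := by linarith
  have hp1 : 0 < p - 1 := by linarith
  have hconj : (p / (p - 1)).HolderConjugate p :=
    (Real.HolderConjugate.conjExponent (by linarith : 1 < p)).symm
  have hae : ∀ {u : ℝ → ℝ}, (∀ s ∈ Icc 0 b, 0 ≤ u s) →
      0 ≤ᵐ[volume.restrict (Ioc 0 b)] u := fun {u} hu =>
    (ae_restrict_iff' measurableSet_Ioc).2
      (Filter.Eventually.of_forall fun x hx => hu x (Ioc_subset_Icc_self hx))
  have h := integral_mul_le_Lp_mul_Lq_of_nonneg (μ := volume.restrict (Ioc 0 b)) hconj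
    (f := fun s => F s ^ (q * ((p - 1) / p))) (g := W)
    (hae fun s hs => Real.rpow_nonneg (hF0 s hs) _) (hae hW0)
    (ContinuousOn.memLp_restrict_Ioc
      (hF.rpow_const fun s _ => Or.inr (by positivity)) _) (hW.memLp_restrict_Ioc _)
  rw [one_div_div] at h
  simp only [intervalIntegral.integral_of_le hb]
  refine h.trans_eq ?_
  congr 2
  refine setIntegral_congr_fun measurableSet_Ioc fun s hs => ?_
  rw [← Real.rpow_mul (hF0 s (Ioc_subset_Icc_self hs))]
  congr 1
  field_simp

/-- Gagliardo–Nirenberg type bound: the oscillation of `‖u‖ ^ (q (p - 1) / p + 1)` is controlled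
by an `L^q` norm of a majorant of `‖u‖` and an `L^p` norm of a majorant of `‖u'‖`. -/
lemma abs_norm_rpow_sub_norm_rpow_le {E : Type*} [NormedAddCommGroup E] [InnerProductSpace ℝ E]
    {p q b x y : ℝ} (hp : 2 ≤ p) (hq : 0 < q) (hx : 0 ≤ x) (hxy : x ≤ y) (hy : y ≤ b)
    {F W : ℝ → ℝ} {u u' : ℝ → E}
    (hF : ContinuousOn F (Icc 0 b)) (hW : ContinuousOn W (Icc 0 b))
    (hu : ∀ s ∈ Icc x y, HasDerivAt u (u' s) s)
    (hF0 : ∀ s ∈ Icc 0 b, 0 ≤ F s) (hW0 : ∀ s ∈ Icc 0 b, 0 ≤ W s)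
    (huF : ∀ s ∈ Icc x y, ‖u s‖ ≤ F s) (huW : ∀ s ∈ Icc x y, ‖u' s‖ ≤ W s) :
    |‖u y‖ ^ (q * ((p - 1) / p) + 1) - ‖u x‖ ^ (q * ((p - 1) / p) + 1)| ≤
      (q * ((p - 1) / p) + 1) *
        ((∫ s in (0)..b, F s ^ q) ^ ((p - 1) / p) * (∫ s in (0)..b, W s ^ p) ^ (1 / p)) := by
  have hc : 0 < (p - 1) / p := div_pos (by linarith) (by linarith)
  set k := q * ((p - 1) / p) with hk
  have hk0 : 0 < k := by positivity
  set φ : ℝ → ℝ := fun s => ‖u s‖ ^ (k + 1)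
  set φ' : ℝ → ℝ := fun s => ((k + 1) * ‖u s‖ ^ (k + 1 - 2)) * inner ℝ (u s) (u' s)
  have hφ : ∀ s ∈ Icc x y, HasDerivAt φ (φ' s) s := fun s hs => by
    have := (hasFDerivAt_norm_rpow (u s) (p := k + 1) (by linarith)).comp_hasDerivAt s (hu s hs)
    simpa [φ, φ', Function.comp_def] using this
  have hb : 0 ≤ b := hx.trans (hxy.trans hy)
  have hsub : Icc x y ⊆ Icc 0 b := Icc_subset_Icc hx hy
  have hbound : ∀ s ∈ Icc x y, ‖φ' s‖ ≤ (k + 1) * (F s ^ k * W s) := fun s hs => by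
    have h1 : ‖u s‖ ^ (k + 1 - 2) * ‖u s‖ = ‖u s‖ ^ k := by
      rcases eq_or_ne (u s) 0 with h | h
      · simp [h, Real.zero_rpow hk0.ne']
      · rw [← Real.rpow_add_one (norm_ne_zero_iff.2 h)]; congr 1; ring
    calc ‖φ' s‖ = (k + 1) * ‖u s‖ ^ (k + 1 - 2) * |inner ℝ (u s) (u' s)| := by
          simp only [φ', norm_mul, Real.norm_eq_abs]
          rw [abs_of_nonneg (by positivity : 0 ≤ k + 1), abs_of_nonneg (by positivity)]
      _ ≤ (k + 1) * ‖u s‖ ^ (k + 1 - 2) * (‖u s‖ * ‖u' s‖) := by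
          gcongr; exact abs_real_inner_le_norm _ _
      _ = (k + 1) * (‖u s‖ ^ k * ‖u' s‖) := by rw [← h1]; ring
      _ ≤ (k + 1) * (F s ^ k * W s) := by
          have := hF0 s (hsub hs)
          have := huF s hs
          have := huW s hs
          gcongr
  have hFW : ContinuousOn (fun s => F s ^ k * W s) (Icc 0 b) :=
    (hF.rpow_const fun s _ => Or.inr hk0.le).mul hW
  have hu_c : ContinuousOn u (Icc x y) := fun s hs => (hu s hs).continuousAt.continuousWithinAt
  have hint : IntervalIntegrable φ' volume x y := by
    rw [intervalIntegrable_iff_integrableOn_Ioc_of_le hxy]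
    refine Integrable.mono' (g := fun s => (k + 1) * (F s ^ k * W s)) ?_ ?_ ?_
    · exact (((hFW.mono hsub).const_smul (k + 1)).integrableOn_Icc).mono_set Ioc_subset_Icc_self
    · have hd : ∀ s ∈ Ioc x y, φ' s = deriv φ s := fun s hs =>
        (hφ s (Ioc_subset_Icc_self hs)).deriv.symm
      exact ((measurable_deriv φ).aestronglyMeasurable).congr
        ((ae_restrict_iff' measurableSet_Ioc).2 (Filter.Eventually.of_forall fun s hs =>
          (hd s hs).symm))
    · exact (ae_restrict_iff' measurableSet_Ioc).2
        (Filter.Eventually.of_forall fun s hs => hbound s (Ioc_subset_Icc_self hs))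
  have hFTC : ∫ s in x..y, φ' s = φ y - φ x :=
    intervalIntegral.integral_eq_sub_of_hasDerivAt (by rwa [uIcc_of_le hxy]) hint
  have hFWi : ∀ {c d : ℝ}, c ≤ d → Icc c d ⊆ Icc 0 b →
      IntervalIntegrable (fun s => F s ^ k * W s) volume c d := fun {c d} hcd h =>
    (hFW.mono (by rwa [uIcc_of_le hcd])).intervalIntegrable
  calc |φ y - φ x| = ‖∫ s in x..y, φ' s‖ := by rw [hFTC, Real.norm_eq_abs]
    _ ≤ ∫ s in x..y, ‖φ' s‖ := intervalIntegral.norm_integral_le_integral_norm hxy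
    _ ≤ ∫ s in x..y, (k + 1) * (F s ^ k * W s) :=
        intervalIntegral.integral_mono_on hxy hint.norm ((hFWi hxy hsub).const_mul _) hbound
    _ = (k + 1) * ∫ s in x..y, F s ^ k * W s := intervalIntegral.integral_const_mul _ _
    _ ≤ (k + 1) * ∫ s in (0)..b, F s ^ k * W s := by
        gcongr
        refine intervalIntegral.integral_mono_interval hx hxy hy ?_ (hFWi hb subset_rfl)
        exact (ae_restrict_iff' measurableSet_Ioc).2 (Filter.Eventually.of_forall fun s hs =>
          mul_nonneg (Real.rpow_nonneg (hF0 s (Ioc_subset_Icc_self hs)) _)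
            (hW0 s (Ioc_subset_Icc_self hs)))
    _ ≤ _ := by
        gcongr
        exact integral_rpow_mul_le hp hq hb hF hW hF0 hW0

/-- One-sided `L^p` Hardy inequality with a remainder term. -/
lemma hardy_with_remainder {E : Type*} [NormedAddCommGroup E] [InnerProductSpace ℝ E]
    {p b : ℝ} (hp : 2 ≤ p) (hb : 0 ≤ b) (hb1 : b < 1) {f f' : ℝ → E}
    (hf : ∀ s ∈ Icc 0 b, HasDerivAt f (f' s) s) (hf' : ContinuousOn f' (Icc 0 b))
    (hfb : f b = 0) :
    ((p - 1) / p) ^ (p - 1) * ‖f 0‖ ^ p +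
        2 * (1 / 2) ^ p * ∫ s in (0)..b, ‖f' s + ((p - 1) / p / (1 - s)) • f s‖ ^ p ≤
      ∫ s in (0)..b, (‖f' s‖ ^ p - ((p - 1) / p) ^ p * ‖f s‖ ^ p / (1 - s) ^ p) := by
  have hp0 : 0 < p := by linarith
  set c := (p - 1) / p with hc
  have hc0 : 0 < c := div_pos (by linarith) hp0
  have hpc : p * c = p - 1 := by rw [hc]; field_simp
  have hδ : ∀ s ∈ Icc 0 b, 0 < 1 - s := fun s hs => by linarith [hs.2]
  have hfc : ContinuousOn f (Icc 0 b) := fun s hs => (hf s hs).continuousAt.continuousWithinAt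
  have hδc : ContinuousOn (fun s : ℝ => 1 - s) (Icc 0 b) := by fun_prop
  set w : ℝ → E := fun s => f' s + (c / (1 - s)) • f s with hw
  have hwc : ContinuousOn w (Icc 0 b) :=
    hf'.add ((continuousOn_const.div hδc fun s hs => (hδ s hs).ne').smul hfc)
  set φ : ℝ → ℝ := fun s => (1 - s) ^ (-(p - 1)) * ‖f s‖ ^ p
  set φ' : ℝ → ℝ := fun s =>
    p * ((1 - s) ^ (-(p - 1)) * (‖f s‖ ^ (p - 2) * inner ℝ (f s) (w s))) with hφ'
  have hsplit : ∀ s, ‖f s‖ ^ p = ‖f s‖ ^ (p - 2) * ‖f s‖ ^ 2 := fun s => by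
    rcases eq_or_ne (f s) 0 with h | h
    · simp [h, Real.zero_rpow hp0.ne']
    · rw [← Real.rpow_natCast ‖f s‖ 2, ← Real.rpow_add (norm_pos_iff.2 h)]
      congr 1; push_cast; ring
  have hφd : ∀ s ∈ Icc 0 b, HasDerivAt φ (φ' s) s := fun s hs => by
    have h1 := (hasFDerivAt_norm_rpow (f s) (p := p) (by linarith)).comp_hasDerivAt s (hf s hs)
    have h2 := ((hasDerivAt_id s).const_sub 1).rpow_const (p := -(p - 1))
      (Or.inl (hδ s hs).ne')
    refine (h2.mul h1).congr_deriv ?_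
    have h3 : (1 - s) ^ (-(p - 1) - 1) = (1 - s) ^ (-(p - 1)) / (1 - s) := by
      rw [Real.rpow_sub_one (hδ s hs).ne']
    simp only [hφ', hw, inner_add_right, inner_smul_right, real_inner_self_eq_norm_sq, id,
      Function.comp_apply, h3, hsplit s, smul_apply, innerSL_apply_apply,
      smul_eq_mul]
    have h4 := (hδ s hs).ne'
    field_simp
    linear_combination (-((1 - s) ^ (-(p - 1)) * ‖f s‖ ^ (p - 2)) * ‖f s‖ ^ 2) * hpc
  have hφ'c : ContinuousOn φ' (Icc 0 b) := by
    refine continuousOn_const.mul ((hδc.rpow_const fun s hs => Or.inl (hδ s hs).ne').mul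
      ((hfc.norm.rpow_const fun s _ => Or.inr (by linarith)).mul (hfc.inner hwc)))
  have hint : ∀ {u : ℝ → ℝ}, ContinuousOn u (Icc 0 b) → IntervalIntegrable u volume 0 b :=
    fun {u} hu => ContinuousOn.intervalIntegrable (by rwa [uIcc_of_le hb])
  have hFTC : ∫ s in (0)..b, φ' s = φ b - φ 0 :=
    intervalIntegral.integral_eq_sub_of_hasDerivAt (by rwa [uIcc_of_le hb]) (hint hφ'c)
  have hφb : φ b = 0 := by simp [φ, hfb, Real.zero_rpow hp0.ne']
  have hφ0 : φ 0 = ‖f 0‖ ^ p := by simp [φ]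
  have hwp : ContinuousOn (fun s => ‖w s‖ ^ p) (Icc 0 b) :=
    hwc.norm.rpow_const fun s _ => Or.inr hp0.le
  have hD : ContinuousOn (fun s => ‖f' s‖ ^ p - c ^ p * ‖f s‖ ^ p / (1 - s) ^ p) (Icc 0 b) :=
    (hf'.norm.rpow_const fun s _ => Or.inr hp0.le).sub
      ((continuousOn_const.mul (hfc.norm.rpow_const fun s _ => Or.inr hp0.le)).div
        (hδc.rpow_const fun s hs => Or.inl (hδ s hs).ne')
        fun s hs => (Real.rpow_pos_of_pos (hδ s hs) _).ne')
  have hpt : ∀ s ∈ Icc 0 b, -c ^ (p - 1) * φ' s + 2 * (1 / 2) ^ p * ‖w s‖ ^ p ≤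
      ‖f' s‖ ^ p - c ^ p * ‖f s‖ ^ p / (1 - s) ^ p := fun s hs => by
    have hd := hδ s hs
    have h := norm_rpow_add_inner_add_le_norm_add_rpow hp (-((c / (1 - s)) • f s)) (w s)
    have h1 : -((c / (1 - s)) • f s) + w s = f' s := by simp [hw]
    have hn : ‖-((c / (1 - s)) • f s)‖ = c / (1 - s) * ‖f s‖ := by
      rw [norm_neg, norm_smul, Real.norm_of_nonneg (by positivity)]
    have h2 : (c / (1 - s) * ‖f s‖) ^ p = c ^ p * ‖f s‖ ^ p / (1 - s) ^ p := by
      rw [Real.mul_rpow (by positivity) (by positivity), Real.div_rpow hc0.le hd.le]; ring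
    have h3 : p * ((c / (1 - s) * ‖f s‖) ^ (p - 2) *
        inner ℝ (-((c / (1 - s)) • f s)) (w s)) = -c ^ (p - 1) * φ' s := by
      have h5 : c ^ (p - 1) = c ^ (p - 2) * c := by
        rw [← Real.rpow_add_one hc0.ne']; congr 1; ring
      have h6 : (1 - s) ^ (-(p - 1)) = ((1 - s) ^ (p - 2) * (1 - s))⁻¹ := by
        rw [Real.rpow_neg hd.le, ← Real.rpow_add_one hd.ne']; congr 2; ring
      rw [Real.mul_rpow (by positivity) (by positivity), Real.div_rpow hc0.le hd.le,
        inner_neg_left, real_inner_smul_left, hφ', h5]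
      simp only [h6]
      have := (Real.rpow_pos_of_pos hd (p - 2)).ne'
      field_simp
    rw [hn, h1, h2, h3] at h
    linarith
  calc c ^ (p - 1) * ‖f 0‖ ^ p + 2 * (1 / 2) ^ p * ∫ s in (0)..b, ‖w s‖ ^ p
      = ∫ s in (0)..b, (-c ^ (p - 1) * φ' s + 2 * (1 / 2) ^ p * ‖w s‖ ^ p) := by
        rw [intervalIntegral.integral_add ((hint hφ'c).const_mul _) ((hint hwp).const_mul _),
          intervalIntegral.integral_const_mul _ φ', hFTC, intervalIntegral.integral_const_mul,
          hφb, hφ0]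
        ring
    _ ≤ _ := intervalIntegral.integral_mono_on hb
        (((hint hφ'c).const_mul _).add ((hint hwp).const_mul _)) (hint hD) hpt

/-- One-sided Hardy–Sobolev inequality on `[0, b]`, with a constant independent of `b < 1`. -/
lemma exists_one_sided_hardy_sobolev {E : Type*} [NormedAddCommGroup E]
    [InnerProductSpace ℝ E] [CompleteSpace E] {p q : ℝ} (hp : 2 ≤ p) (hq : 0 < q) :
    ∃ K : ℝ, 0 < K ∧ ∀ (b : ℝ) (f f' : ℝ → E), 0 ≤ b → b < 1 →
      (∀ s ∈ Icc 0 b, HasDerivAt f (f' s) s) → ContinuousOn f' (Icc 0 b) → f b = 0 →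
      ∀ t ∈ Icc 0 b, ‖f t‖ ^ (q * (p - 1) + p) ≤ K *
        (∫ s in (0)..b, (‖f' s‖ ^ p - ((p - 1) / p) ^ p * ‖f s‖ ^ p / (1 - s) ^ p)) *
        (∫ s in (0)..b, ‖f s‖ ^ q) ^ (p - 1) := by
  have hp0 : 0 < p := by linarith
  set c := (p - 1) / p with hc
  have hc0 : 0 < c := div_pos (by linarith) hp0
  have hc1 : c ≤ 1 := by rw [hc, div_le_one hp0]; linarith
  have hpc : c * p = p - 1 := by rw [hc]; field_simp
  set a₀ := c ^ (p - 1)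
  set a₁ : ℝ := 2 * (1 / 2) ^ p
  have ha₀ : 0 < a₀ := by positivity
  have ha₁ : 0 < a₁ := by positivity
  set κ := 1 / a₀ + 1 / a₁ with hκ
  have hκ0 : 0 < κ := by positivity
  set L : ℝ := (2 ^ (p - 1) * (1 + 4 ^ p)) ^ (1 / p)
  set r := q * c + 1
  have hr : 0 < r := by positivity
  refine ⟨(r * (1 + L)) ^ p * κ, by positivity, fun b f f' hb hb1 hf hf' hfb t ht => ?_⟩
  have hδ : ∀ s ∈ Icc 0 b, 0 < 1 - s := fun s hs => by linarith [hs.2]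
  have hfc : ContinuousOn f (Icc 0 b) := fun s hs => (hf s hs).continuousAt.continuousWithinAt
  have hδc : ContinuousOn (fun s : ℝ => 1 - s) (Icc 0 b) := by fun_prop
  have hH := hardy_with_remainder hp hb hb1 hf hf' hfb
  rw [← hc] at hH
  set D := ∫ s in (0)..b, (‖f' s‖ ^ p - c ^ p * ‖f s‖ ^ p / (1 - s) ^ p)
  set N := ∫ s in (0)..b, ‖f s‖ ^ q
  set w : ℝ → E := fun s => f' s + (c / (1 - s)) • f s with hw
  have hwc : ContinuousOn w (Icc 0 b) :=
    hf'.add ((continuousOn_const.div hδc fun s hs => (hδ s hs).ne').smul hfc)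
  have hint : ∀ {u : ℝ → ℝ}, ContinuousOn u (Icc 0 b) → IntervalIntegrable u volume 0 b :=
    fun {u} hu => ContinuousOn.intervalIntegrable (by rwa [uIcc_of_le hb])
  have hwp : ContinuousOn (fun s => ‖w s‖ ^ p) (Icc 0 b) :=
    hwc.norm.rpow_const fun s _ => Or.inr hp0.le
  set I := ∫ s in (0)..b, ‖w s‖ ^ p
  have hI0 : 0 ≤ I := intervalIntegral.integral_nonneg hb fun s _ => by positivity
  have hN0 : 0 ≤ N := intervalIntegral.integral_nonneg hb fun s _ => by positivity
  have hD0 : 0 ≤ D := le_trans (by positivity) hH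
  have hfD : ‖f 0‖ ^ p ≤ κ * D := by
    have h1 : ‖f 0‖ ^ p ≤ 1 / a₀ * D := by
      rw [one_div, ← div_eq_inv_mul, le_div_iff₀ ha₀]
      have : 0 ≤ a₁ * I := by positivity
      linarith
    have : 0 ≤ 1 / a₁ * D := by positivity
    rw [hκ]; linarith
  have hID : I ≤ κ * D := by
    have h1 : I ≤ 1 / a₁ * D := by
      rw [one_div, ← div_eq_inv_mul, le_div_iff₀ ha₁]
      have : 0 ≤ a₀ * ‖f 0‖ ^ p := by positivity
      linarith
    have : 0 ≤ 1 / a₀ * D := by positivity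
    rw [hκ]; linarith
  set d := (κ * D) ^ (1 / p) with hd
  have hd0 : 0 ≤ d := by positivity
  have hdp : d ^ p = κ * D := by
    rw [hd, ← Real.rpow_mul (by positivity), one_div_mul_cancel hp0.ne', Real.rpow_one]
  have hf0d : ‖f 0‖ ≤ d := by
    rw [← hdp] at hfD
    exact (Real.rpow_le_rpow_iff (norm_nonneg _) hd0 hp0).1 hfD
  have hId : I ^ (1 / p) ≤ d := Real.rpow_le_rpow hI0 hID (by positivity)
  -- the rescaled function `u = ((1 - t) / (1 - s)) ^ c • f` satisfies `‖u‖ ≤ ‖f‖`, `‖u'‖ ≤ ‖w‖`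
  have hρ : ∀ t ∈ Icc 0 b, ∀ s ∈ Icc 0 t,
      0 ≤ (1 - t) ^ c * (1 - s) ^ (-c) ∧ (1 - t) ^ c * (1 - s) ^ (-c) ≤ 1 := fun t ht s hs => by
    have h1 := hδ t ht
    have h2 := hδ s ⟨hs.1, hs.2.trans ht.2⟩
    refine ⟨by positivity, ?_⟩
    rw [Real.rpow_neg h2.le, ← div_eq_mul_inv, div_le_one (by positivity)]
    exact Real.rpow_le_rpow h1.le (by linarith [hs.2]) hc0.le
  have hu : ∀ t ∈ Icc 0 b, ∀ s ∈ Icc 0 t,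
      HasDerivAt (fun s => ((1 - t) ^ c * (1 - s) ^ (-c)) • f s)
        (((1 - t) ^ c * (1 - s) ^ (-c)) • w s) s := fun t ht s hs => by
    have hs' : s ∈ Icc 0 b := ⟨hs.1, hs.2.trans ht.2⟩
    have h2 := (((hasDerivAt_id s).const_sub 1).rpow_const (p := -c)
      (Or.inl (hδ s hs').ne')).const_mul ((1 - t) ^ c)
    refine (h2.smul (hf s hs')).congr_deriv ?_
    simp only [id, hw, smul_add, smul_smul, Real.rpow_sub_one (hδ s hs').ne']
    congr 2
    ring
  have hnorm : ∀ t ∈ Icc 0 b, ∀ s ∈ Icc 0 t, ∀ v : E,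
      ‖((1 - t) ^ c * (1 - s) ^ (-c)) • v‖ ≤ ‖v‖ := fun t ht s hs v => by
    rw [norm_smul, Real.norm_of_nonneg (hρ t ht s hs).1]
    exact mul_le_of_le_one_left (norm_nonneg _) (hρ t ht s hs).2
  have hut : ∀ t ∈ Icc 0 b, ((1 - t) ^ c * (1 - t) ^ (-c)) • f t = f t := fun t ht => by
    rw [← Real.rpow_add (hδ t ht), add_neg_cancel, Real.rpow_zero, one_smul]
  have hsup : ∀ t ∈ Icc 0 b, ‖f t‖ ≤ 2 * d := fun t ht => by
    have hsub : Icc 0 t ⊆ Icc 0 b := Icc_subset_Icc_right ht.2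
    have hcont : ContinuousOn (fun s => ((1 - t) ^ c * (1 - s) ^ (-c)) • w s) (Icc 0 t) :=
      (continuousOn_const.mul ((hδc.mono hsub).rpow_const
        fun s hs => Or.inl (hδ s (hsub hs)).ne')).smul (hwc.mono hsub)
    have hi : IntervalIntegrable (fun s => ((1 - t) ^ c * (1 - s) ^ (-c)) • w s) volume 0 t :=
      ContinuousOn.intervalIntegrable (by rwa [uIcc_of_le ht.1])
    have hFTC := intervalIntegral.integral_eq_sub_of_hasDerivAt
      (by rw [uIcc_of_le ht.1]; exact hu t ht) hi
    have hwi : IntervalIntegrable (fun s => ‖w s‖) volume 0 b := hint hwc.norm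
    have h1 : ‖∫ s in (0)..t, ((1 - t) ^ c * (1 - s) ^ (-c)) • w s‖ ≤ ∫ s in (0)..b, ‖w s‖ :=
      calc _ ≤ ∫ s in (0)..t, ‖((1 - t) ^ c * (1 - s) ^ (-c)) • w s‖ :=
            intervalIntegral.norm_integral_le_integral_norm ht.1
        _ ≤ ∫ s in (0)..t, ‖w s‖ := by
            refine intervalIntegral.integral_mono_on ht.1 hi.norm ?_
              fun s hs => hnorm t ht s hs _
            exact ContinuousOn.intervalIntegrable
              (by rw [uIcc_of_le ht.1]; exact hwc.norm.mono hsub)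
        _ ≤ ∫ s in (0)..b, ‖w s‖ :=
            intervalIntegral.integral_mono_interval le_rfl ht.1 ht.2
              (Filter.Eventually.of_forall fun s => norm_nonneg _) hwi
    have h2 := integral_rpow_mul_le hp one_pos hb (F := fun _ => 1) (W := fun s => ‖w s‖)
      continuousOn_const hwc.norm (fun _ _ => zero_le_one) (fun _ _ => norm_nonneg _)
    simp only [Real.one_rpow, one_mul, intervalIntegral.integral_const, sub_zero, smul_eq_mul,
      mul_one] at h2
    have h3 : b ^ ((p - 1) / p) ≤ 1 := Real.rpow_le_one hb hb1.le hc0.le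
    have h4 : ∫ s in (0)..b, ‖w s‖ ≤ d :=
      h2.trans ((mul_le_of_le_one_left (by positivity) h3).trans hId)
    have h5 := hnorm t ht 0 ⟨le_rfl, ht.1⟩ (f 0)
    rw [hut t ht] at hFTC
    calc ‖f t‖ = ‖(f t - ((1 - t) ^ c * (1 - 0) ^ (-c)) • f 0) +
          ((1 - t) ^ c * (1 - 0) ^ (-c)) • f 0‖ := by rw [sub_add_cancel]
      _ ≤ ‖f t - ((1 - t) ^ c * (1 - 0) ^ (-c)) • f 0‖ +
          ‖((1 - t) ^ c * (1 - 0) ^ (-c)) • f 0‖ := norm_add_le _ _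
      _ ≤ d + d := add_le_add (by rw [← hFTC]; exact h1.trans h4) (h5.trans hf0d)
      _ = 2 * d := by ring
  have hft : ‖f t‖ ^ r ≤ ‖f 0‖ ^ r + r * (N ^ c * d) := by
    have h := abs_norm_rpow_sub_norm_rpow_le hp hq le_rfl ht.1 ht.2 hfc.norm hwc.norm
      (hu t ht) (fun _ _ => norm_nonneg _) (fun _ _ => norm_nonneg _)
      (fun s hs => hnorm t ht s hs _) (fun s hs => hnorm t ht s hs _)
    rw [← hc, hut t ht] at h
    have h1 : ‖f t‖ ^ r - ‖((1 - t) ^ c * (1 - 0) ^ (-c)) • f 0‖ ^ r ≤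
        r * (N ^ c * I ^ (1 / p)) := (le_abs_self _).trans h
    have h2 : ‖((1 - t) ^ c * (1 - 0) ^ (-c)) • f 0‖ ^ r ≤ ‖f 0‖ ^ r :=
      Real.rpow_le_rpow (norm_nonneg _) (hnorm t ht 0 ⟨le_rfl, ht.1⟩ _) hr.le
    have h3 : r * (N ^ c * I ^ (1 / p)) ≤ r * (N ^ c * d) := by gcongr
    exact (sub_le_iff_le_add'.1 (h1.trans h3)).trans (add_le_add h2 le_rfl)
  have hf0 : ‖f 0‖ ^ r ≤ r * (N ^ c * (L * d)) := by
    have hW : ContinuousOn (fun s => ‖w s‖ + 4 * d) (Icc 0 b) := hwc.norm.add continuousOn_const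
    have hh : ∀ s ∈ Icc 0 b, HasDerivAt (fun s => (1 - s) • f s)
        ((1 - s) • f' s + (-1 : ℝ) • f s) s := fun s hs =>
      ((hasDerivAt_id s).const_sub 1).smul (hf s hs)
    have hh' : ∀ s ∈ Icc 0 b, ‖(1 - s) • f' s + (-1 : ℝ) • f s‖ ≤ ‖w s‖ + 4 * d :=
      fun s hs => by
        have hds := hδ s hs
        have h1 : (1 - s) • f' s + (-1 : ℝ) • f s = (1 - s) • w s - (1 + c) • f s := by
          rw [hw, smul_add, smul_smul, mul_div_cancel₀ _ hds.ne']; module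
        rw [h1]
        refine (norm_sub_le _ _).trans (add_le_add ?_ ?_)
        · rw [norm_smul, Real.norm_of_nonneg hds.le]
          exact mul_le_of_le_one_left (norm_nonneg _) (by linarith [hs.1])
        · rw [norm_smul, Real.norm_of_nonneg (by positivity)]
          calc (1 + c) * ‖f s‖ ≤ 2 * (2 * d) :=
                mul_le_mul (by linarith) (hsup s hs) (norm_nonneg _) (by norm_num)
            _ = 4 * d := by ring
    have h := abs_norm_rpow_sub_norm_rpow_le hp hq le_rfl hb le_rfl hfc.norm hW hh
      (fun _ _ => norm_nonneg _) (fun s _ => by positivity)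
      (fun s hs => by
        rw [norm_smul, Real.norm_of_nonneg (hδ s hs).le]
        exact mul_le_of_le_one_left (norm_nonneg _) (by linarith [hs.1])) hh'
    have hWp : ∫ s in (0)..b, (‖w s‖ + 4 * d) ^ p ≤ 2 ^ (p - 1) * (1 + 4 ^ p) * (κ * D) := by
      have hpt : ∀ s ∈ Icc 0 b, (‖w s‖ + 4 * d) ^ p ≤
          2 ^ (p - 1) * (‖w s‖ ^ p + (4 * d) ^ p) := fun s _ => by
        have := NNReal.rpow_add_le_mul_rpow_add_rpow ‖w s‖₊ ⟨4 * d, by positivity⟩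
          (by linarith : 1 ≤ p)
        exact_mod_cast this
      have hwd : ContinuousOn (fun s => 2 ^ (p - 1) * (‖w s‖ ^ p + (4 * d) ^ p)) (Icc 0 b) :=
        continuousOn_const.mul (hwp.add continuousOn_const)
      refine (intervalIntegral.integral_mono_on hb
        (hint (hW.rpow_const fun _ _ => Or.inr hp0.le))
        (hint hwd) hpt).trans ?_
      rw [intervalIntegral.integral_const_mul, intervalIntegral.integral_add (hint hwp)
        (by simp), intervalIntegral.integral_const, Real.mul_rpow (by norm_num) hd0, hdp,
        smul_eq_mul, sub_zero, mul_assoc]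
      have h1 : b * (4 ^ p * (κ * D)) ≤ 4 ^ p * (κ * D) :=
        mul_le_of_le_one_left (by positivity) hb1.le
      gcongr
      linarith
    have hL : (∫ s in (0)..b, (‖w s‖ + 4 * d) ^ p) ^ (1 / p) ≤ L * d := by
      rw [hd, ← Real.mul_rpow (by positivity) (by positivity)]
      refine Real.rpow_le_rpow ?_ hWp (by positivity)
      exact intervalIntegral.integral_nonneg hb fun s _ => by positivity
    simp only [hfb, smul_zero, norm_zero, sub_zero, one_smul, ← hc] at h
    rw [Real.zero_rpow hr.ne', zero_sub, abs_neg, abs_of_nonneg (by positivity)] at h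
    refine h.trans ?_
    gcongr
  have hfin : ‖f t‖ ^ r ≤ r * (1 + L) * N ^ c * d := by linarith
  calc ‖f t‖ ^ (q * (p - 1) + p) = (‖f t‖ ^ r) ^ p := by
        rw [← Real.rpow_mul (norm_nonneg _)]; congr 1
        linear_combination (-q) * hpc
    _ ≤ (r * (1 + L) * N ^ c * d) ^ p := Real.rpow_le_rpow (by positivity) hfin hp0.le
    _ = (r * (1 + L)) ^ p * κ * D * N ^ (p - 1) := by
        rw [Real.mul_rpow (by positivity) hd0, Real.mul_rpow (by positivity) (by positivity),
          ← Real.rpow_mul hN0, hpc, hdp]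
        ring

/-- A compact subset of `(-1, 1)` is contained in some `(-b, b)` with `b < 1`. -/
lemma exists_abs_lt_of_isCompact_subset_Ioo {K : Set ℝ} (hK : IsCompact K)
    (hsub : K ⊆ Ioo (-1) 1) : ∃ b : ℝ, 0 ≤ b ∧ b < 1 ∧ ∀ s ∈ K, |s| < b := by
  obtain ⟨x, hx, hmax⟩ := (hK.insert 0).exists_isMaxOn (insert_nonempty _ _)
    continuous_abs.continuousOn
  have hx1 : |x| < 1 := by
    rcases hx with rfl | hx
    · simp
    · exact abs_lt.2 (hsub hx)
  refine ⟨(1 + |x|) / 2, by positivity, by linarith, fun s hs => ?_⟩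
  have : |s| ≤ |x| := hmax (mem_insert_of_mem 0 hs)
  linarith

/-- **One-dimensional `L^p` Hardy–Sobolev inequality** (Proposition 2): for `q ≥ p ≥ 2` there
is a constant `C_{p,q} > 0` such that for every `f ∈ C_0^∞(−1,1)` and every `t ∈ [−1,1]`,
`|f(t)|^{q(p−1)+p} ≤ C_{p,q} (∫_{−1}^1 (|f'|^p − ((p−1)/p)^p |f|^p/(1−|s|)^p) ds)
(∫_{−1}^1 |f|^q ds)^{p−1}`. -/
theorem one_dim_hardy_sobolev_p (p q : ℝ) (hp : 2 ≤ p) (hpq : p ≤ q) :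
    ∃ C : ℝ, 0 < C ∧ ∀ f : ℝ → ℂ, ContDiff ℝ (⊤ : ℕ∞) f → HasCompactSupport f →
      tsupport f ⊆ Set.Ioo (-1) 1 → ∀ t ∈ Set.Icc (-1 : ℝ) 1,
      ‖f t‖ ^ (q * (p - 1) + p) ≤ C *
        (∫ s in Set.Ioo (-1 : ℝ) 1,
          (‖deriv f s‖ ^ p - ((p - 1) / p) ^ p * ‖f s‖ ^ p / (1 - |s|) ^ p)) *
        (∫ s in Set.Ioo (-1 : ℝ) 1, ‖f s‖ ^ q) ^ (p - 1) := by
  obtain ⟨K, hK0, hK⟩ := exists_one_sided_hardy_sobolev (E := ℂ) hp (by linarith : 0 < q)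
  refine ⟨K, hK0, fun f hf hfs hsub t ht => ?_⟩
  have hp0 : 0 < p := by linarith
  have hq0 : 0 < q := by linarith
  obtain ⟨b, hb, hb1, hKb⟩ := exists_abs_lt_of_isCompact_subset_Ioo hfs.isCompact hsub
  have hzero : ∀ s, b ≤ |s| → f s = 0 := fun s hs =>
    image_eq_zero_of_notMem_tsupport fun h => (hKb s h).not_ge hs
  have hzero' : ∀ s, b ≤ |s| → deriv f s = 0 := fun s hs =>
    image_eq_zero_of_notMem_tsupport fun h => (hKb s (tsupport_deriv_subset h)).not_ge hs
  have hd : ∀ s, HasDerivAt f (deriv f s) s := fun s =>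
    (hf.differentiable (by simp) s).hasDerivAt
  have hd' : ∀ s, HasDerivAt (fun s => f (-s)) (-deriv f (-s)) s := fun s => by
    simpa [Function.comp_def] using (hd (-s)).scomp s (hasDerivAt_neg s)
  have hdc : Continuous (deriv f) := hf.continuous_deriv (by simp)
  have hright := hK b f (deriv f) hb hb1 (fun s _ => hd s) hdc.continuousOn
    (hzero b (le_abs_self b))
  have hleft := hK b (fun s => f (-s)) (fun s => -deriv f (-s)) hb hb1 (fun s _ => hd' s)
    (by fun_prop) (hzero (-b) (by rw [abs_neg]; exact le_abs_self b))
  set c := (p - 1) / p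
  have hc0 : 0 < c := div_pos (by linarith) hp0
  set G : ℝ → ℝ := fun s => ‖deriv f s‖ ^ p - c ^ p * ‖f s‖ ^ p / (1 - |s|) ^ p with hG
  have hδ : ∀ s ∈ Icc (-b) b, 0 < 1 - |s| := fun s hs => by linarith [abs_le.2 hs]
  have hGc : ContinuousOn G (Icc (-b) b) := by
    have hfc := hf.continuous
    refine (hdc.norm.rpow_const fun s => Or.inr hp0.le).continuousOn.sub
      ((continuous_const.mul (hfc.norm.rpow_const fun s => Or.inr hp0.le)).continuousOn.div
        (ContinuousOn.rpow_const (by fun_prop) fun s hs => Or.inl (hδ s hs).ne')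
        fun s hs => (Real.rpow_pos_of_pos (hδ s hs) _).ne')
  have hFc : Continuous fun s => ‖f s‖ ^ q :=
    hf.continuous.norm.rpow_const fun s => Or.inr hq0.le
  -- integrals over `(-1, 1)` split into the two halves of `[-b, b]`
  have hsplit : ∀ u : ℝ → ℝ, ContinuousOn u (Icc (-b) b) → (∀ s, b ≤ |s| → u s = 0) →
      ∫ s in Ioo (-1 : ℝ) 1, u s = (∫ s in (0)..b, u (-s)) + ∫ s in (0)..b, u s := by
    intro u hu hu0
    have hi : ∀ {x y : ℝ}, x ∈ Icc (-b) b → y ∈ Icc (-b) b → IntervalIntegrable u volume x y :=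
      fun hx hy => (hu.mono (uIcc_subset_Icc hx hy)).intervalIntegrable
    rw [intervalIntegral.integral_comp_neg, neg_zero,
      intervalIntegral.integral_add_adjacent_intervals
        (hi ⟨le_rfl, by linarith⟩ ⟨by linarith, hb⟩) (hi ⟨by linarith, hb⟩ ⟨by linarith, le_rfl⟩),
      intervalIntegral.integral_of_le (by linarith)]
    refine setIntegral_eq_of_subset_of_forall_sdiff_eq_zero measurableSet_Ioo
      (fun s hs => ⟨by linarith [hs.1], by linarith [hs.2]⟩) fun s hs => hu0 s ?_
    by_contra! h
    exact hs.2 ⟨(abs_lt.1 h).1, (abs_lt.1 h).2.le⟩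
  have hGs := hsplit G hGc fun s hs => by
    simp [hG, hzero s hs, hzero' s hs, Real.zero_rpow hp0.ne']
  have hFs := hsplit (fun s => ‖f s‖ ^ q) hFc.continuousOn fun s hs => by
    simp [hzero s hs, Real.zero_rpow hq0.ne']
  have hGr : ∫ s in (0)..b, G s =
      ∫ s in (0)..b, (‖deriv f s‖ ^ p - c ^ p * ‖f s‖ ^ p / (1 - s) ^ p) :=
    intervalIntegral.integral_congr fun s hs => by
      rw [uIcc_of_le hb] at hs
      simp only [hG, abs_of_nonneg hs.1]
  have hGl : ∫ s in (0)..b, G (-s) =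
      ∫ s in (0)..b, (‖-deriv f (-s)‖ ^ p - c ^ p * ‖f (-s)‖ ^ p / (1 - s) ^ p) :=
    intervalIntegral.integral_congr fun s hs => by
      rw [uIcc_of_le hb] at hs
      simp only [hG, abs_neg, norm_neg, abs_of_nonneg hs.1]
  rw [hGs, hFs, hGl, hGr]
  have hDr := hardy_with_remainder hp hb hb1 (fun s _ => hd s) hdc.continuousOn
    (hzero b (le_abs_self b))
  have hDl := hardy_with_remainder hp hb hb1 (f := fun s => f (-s)) (fun s _ => hd' s)
    (by fun_prop) (hzero (-b) (by rw [abs_neg]; exact le_abs_self b))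
  have hnn : ∀ v : ℝ → ℝ, (∀ s, 0 ≤ v s) → 0 ≤ ∫ s in (0)..b, v s := fun v hv =>
    intervalIntegral.integral_nonneg hb fun s _ => hv s
  have hDr0 := le_trans (add_nonneg (by positivity) (mul_nonneg (by positivity)
    (hnn _ fun s => by positivity))) hDr
  have hDl0 := le_trans (add_nonneg (by positivity) (mul_nonneg (by positivity)
    (hnn _ fun s => by positivity))) hDl
  have hNr0 := hnn (fun s => ‖f s‖ ^ q) fun s => by positivity
  have hNl0 := hnn (fun s => ‖f (-s)‖ ^ q) fun s => by positivity
  rcases le_or_gt b |t| with htb | htb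
  · rw [hzero t htb, norm_zero, Real.zero_rpow (by nlinarith)]
    exact mul_nonneg (mul_nonneg hK0.le (add_nonneg hDl0 hDr0))
      (Real.rpow_nonneg (add_nonneg hNl0 hNr0) _)
  rcases le_total 0 t with ht0 | ht0
  · refine (hright t ⟨ht0, (le_abs_self t).trans htb.le⟩).trans ?_
    gcongr
    · exact le_add_of_nonneg_left hDl0
    · linarith
    · exact le_add_of_nonneg_left hNl0
  · have h := hleft (-t) ⟨by linarith, (neg_le_abs t).trans htb.le⟩
    rw [neg_neg] at h
    refine h.trans ?_
    gcongr
    · exact le_add_of_nonneg_right hDr0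
    · linarith
    · exact le_add_of_nonneg_right hNr0
end
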